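/- arXiv:2310.15619 — 2 statements merged into one kernel-verified Lean document; each statement's English description precedes it below -/
import Mathlib

section
/- Let f ∈ ℤ[t] be a nonzero polynomial which does not vanish at any root of unity, let p be a prime, and let β_1, …, β_d ∈ ℚ̄_p be the roots of f counted with multiplicity. Set μ_p(f) := −m_p(f)/log p and λ_p(f) := #{j ∈ {1,…,d} : |β_j|_p = 1 and |β_j − 1|_p < 1}. Then there exist a constant k_0 ∈ ℕ and an integer ν_p(f) ∈ ℤ such that for every integer k ≥ k_0 one has ord_p(Δ_{p^k}(f)) = μ_p(f)·p^k + λ_p(f)·k + ν_p(f). -/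
open Polynomial

/-- The Pierce–Lehmer sequence `Δ_n(f) = a_d^n ∏_i (α_i^n - 1)` of an integer polynomial,
computed inside a field `K` containing all the roots of `f`. -/
noncomputable def pierceLehmer (K : Type*) [Field K] (f : Polynomial ℤ) (n : ℕ) : K :=
  ((f.map (Int.castRingHom K)).leadingCoeff) ^ n *
    (((f.map (Int.castRingHom K)).roots).map (fun α => α ^ n - 1)).prod

/-- The Mahler measure `|a_d| ∏_i max(1, |α_i|)` of an integer polynomial, computed using
the norm of a normed field `K` containing all the roots of `f`. -/
noncomputable def mahlerMeasure (K : Type*) [NormedField K] (f : Polynomial ℤ) : ℝ :=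
  ‖(f.map (Int.castRingHom K)).leadingCoeff‖ *
    (((f.map (Int.castRingHom K)).roots).map (fun α => max 1 ‖α‖)).prod

/-- The additive `p`-adic valuation `ord_p(x) = -log ‖x‖ / log p` on a normed field. -/
noncomputable def ordp (p : ℕ) {K : Type*} [NormedField K] (x : K) : ℝ :=
  -(Real.log ‖x‖ / Real.log p)

open scoped Classical

section aux

variable {K : Type*} [NormedField K]

theorem aux_norm_eval_le [IsUltrametricDist K] (r : ℤ[X]) (y : K) (hy : ‖y‖ ≤ 1) :
    ‖aeval y r‖ ≤ 1 := by
  rw [aeval_eq_sum_range]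
  refine IsUltrametricDist.norm_sum_le_of_forall_le_of_nonneg zero_le_one ?_
  intro i _
  rw [zsmul_eq_mul, norm_mul, norm_pow]
  exact mul_le_one₀ (IsUltrametricDist.norm_intCast_le_one K _) (by positivity)
    (pow_le_one₀ (norm_nonneg _) hy)

/-- if `‖a - b‖ < ‖b‖`, then `‖a‖ = ‖b‖` -/
theorem aux_norm_eq [IsUltrametricDist K] (a b : K) (h : ‖a - b‖ < ‖b‖) : ‖a‖ = ‖b‖ := by
  have := IsUltrametricDist.norm_add_eq_max_of_norm_ne_norm (x := a - b) (y := b) h.ne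
  rw [sub_add_cancel, max_eq_right h.le] at this
  exact this

theorem aux_pow_sub_one [IsUltrametricDist K] (b : K) (hb : ‖b‖ ≤ 1) (i : ℕ) :
    ‖b ^ i - 1‖ ≤ ‖b - 1‖ := by
  rw [← geom_sum_mul, norm_mul]
  refine mul_le_of_le_one_left (norm_nonneg _) ?_
  refine IsUltrametricDist.norm_sum_le_of_forall_le_of_nonneg zero_le_one ?_
  intro i _
  rw [norm_pow]
  exact pow_le_one₀ (norm_nonneg _) hb

theorem aux_geom [IsUltrametricDist K] (b : K) (hb : ‖b‖ ≤ 1) (n : ℕ) :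
    ‖(∑ i ∈ Finset.range n, b ^ i) - (n : K)‖ ≤ ‖b - 1‖ := by
  have : (∑ i ∈ Finset.range n, b ^ i) - (n : K) = ∑ i ∈ Finset.range n, (b ^ i - 1) := by
    simp
  rw [this]
  exact IsUltrametricDist.norm_sum_le_of_forall_le_of_nonneg (norm_nonneg _)
    fun i _ => aux_pow_sub_one b hb i

/-- the case of residue different from one -/
theorem aux_unit [IsUltrametricDist K] (p : ℕ) (hp : p.Prime) (hpn : ‖(p : K)‖ < 1)
    (b : K) (hb : ‖b‖ = 1) (hb1 : ‖b - 1‖ = 1) (k : ℕ) :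
    ‖b ^ (p ^ k) - 1‖ = 1 := by
  induction k with
  | zero => simpa using hb1
  | succ k ih =>
    obtain ⟨r, hr⟩ := exists_add_pow_prime_eq hp (X : ℤ[X]) 1
    set c := b ^ (p ^ k) with hc
    have h2 := congrArg (aeval (c - 1)) hr
    simp only [map_pow, map_add, map_mul, aeval_X, map_one, sub_add_cancel, one_pow, mul_one,
      map_natCast] at h2
    rw [pow_succ, pow_mul, ← hc]
    have h3 : (c ^ p - 1) - (c - 1) ^ p = p * ((c - 1) * aeval (c - 1) r) := by
      rw [h2]; ring
    have h4 : ‖(c - 1) ^ p‖ = 1 := by rw [norm_pow, ih, one_pow]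
    rw [← h4]
    apply aux_norm_eq
    rw [h3, h4, norm_mul, norm_mul, ih, one_mul]
    calc _ ≤ ‖(p : K)‖ * 1 := by
            gcongr
            exact aux_norm_eval_le _ _ ih.le
      _ < 1 := by simpa using hpn

theorem aux_one [IsUltrametricDist K] (p : ℕ) (hpn : ‖(p : K)‖ < 1)
    (hp0 : 0 < ‖(p : K)‖)
    (b : K) (hb : ‖b‖ = 1) (hb1 : ‖b - 1‖ < 1) :
    ∃ k₀, ∀ j : ℕ, ‖b ^ (p ^ (k₀ + j)) - 1‖ = ‖(p : K)‖ ^ j * ‖b ^ (p ^ k₀) - 1‖ := by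
  have hn : ∀ k : ℕ, ‖b ^ (p ^ k)‖ = 1 := fun k => by rw [norm_pow, hb, one_pow]
  have hstep : ∀ k : ℕ, ‖b ^ (p ^ (k + 1)) - 1‖ =
      ‖∑ i ∈ Finset.range p, (b ^ (p ^ k)) ^ i‖ * ‖b ^ (p ^ k) - 1‖ := by
    intro k
    rw [← norm_mul, geom_sum_mul, pow_succ, pow_mul]
  set r := max ‖(p : K)‖ ‖b - 1‖ with hr
  have hr1 : r < 1 := max_lt hpn hb1
  have hr0 : 0 ≤ r := le_max_of_le_left hp0.le
  have hbound : ∀ k : ℕ, ‖b ^ (p ^ k) - 1‖ ≤ r ^ (k + 1) := by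
    intro k
    induction k with
    | zero => simp [hr]
    | succ k ih =>
      rw [hstep, pow_succ' r]
      refine mul_le_mul ?_ ih (norm_nonneg _) hr0
      have h1 := aux_geom (b ^ (p ^ k)) (hn k).le p
      have h2 := aux_pow_sub_one b hb.le (p ^ k)
      have h3 := IsUltrametricDist.norm_add_le_max
        ((∑ i ∈ Finset.range p, (b ^ (p ^ k)) ^ i) - (p : K)) (p : K)
      rw [sub_add_cancel] at h3
      refine h3.trans (max_le ((h1.trans h2).trans (le_max_right _ _)) (le_max_left _ _))
  obtain ⟨k₀, hk₀⟩ := exists_pow_lt_of_lt_one hp0 hr1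
  refine ⟨k₀, fun j => ?_⟩
  induction j with
  | zero => simp
  | succ j ih =>
    rw [← add_assoc, hstep, ih, pow_succ', mul_assoc]
    congr 1
    apply aux_norm_eq
    refine (aux_geom _ (hn _).le p).trans_lt ((hbound _).trans_lt (lt_of_le_of_lt ?_ hk₀))
    exact pow_le_pow_of_le_one hr0 hr1.le (by omega)

theorem aux_root [IsUltrametricDist K] (p : ℕ) (hp : p.Prime)
    (hpn : ‖(p : K)‖ = (p : ℝ)⁻¹) (b : K) (hb : ¬ IsOfFinOrder b) :
    ∃ (k₀ : ℕ) (c : ℝ), ∀ k, k₀ ≤ k → Real.log ‖b ^ (p ^ k) - 1‖ =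
      (p : ℝ) ^ k * Real.log (max 1 ‖b‖)
        - (if ‖b‖ = 1 ∧ ‖b - 1‖ < 1 then 1 else 0) * (k * Real.log p) + c := by
  have hp1 : (1 : ℝ) < p := by exact_mod_cast hp.one_lt
  have hplt : ‖(p : K)‖ < 1 := by rw [hpn]; exact inv_lt_one_of_one_lt₀ hp1
  have hpp : 0 < ‖(p : K)‖ := by rw [hpn]; positivity
  have hpk : ∀ k : ℕ, p ^ k ≠ 0 := fun k => pow_ne_zero _ hp.ne_zero
  rcases lt_trichotomy ‖b‖ 1 with h | h | h
  · refine ⟨0, 0, fun k _ => ?_⟩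
    have h1 : ‖b ^ (p ^ k) - 1‖ = 1 := by
      have : ‖b ^ (p ^ k) - 1‖ = ‖(-1 : K)‖ := by
        apply aux_norm_eq
        simpa using pow_lt_one₀ (norm_nonneg _) h (hpk k)
      simpa using this
    simp [h1, h.ne, max_eq_left h.le]
  · by_cases h1 : ‖b - 1‖ < 1
    · obtain ⟨k₀, hk⟩ := aux_one p hplt hpp b h h1
      refine ⟨k₀, Real.log ‖b ^ (p ^ k₀) - 1‖ + k₀ * Real.log p, fun k hkk => ?_⟩
      obtain ⟨j, rfl⟩ := Nat.exists_eq_add_of_le hkk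
      have hne : ‖b ^ (p ^ k₀) - 1‖ ≠ 0 := by
        rw [norm_ne_zero_iff, sub_ne_zero]
        intro h
        exact hb (isOfFinOrder_iff_pow_eq_one.2 ⟨_, Nat.pos_of_ne_zero (hpk k₀), h⟩)
      rw [hk, Real.log_mul (by positivity) hne, Real.log_pow, hpn, Real.log_inv]
      simp [h, h1]
      ring
    · have h2 : ‖b - 1‖ = 1 := by
        refine le_antisymm ?_ (not_lt.1 h1)
        have := IsUltrametricDist.norm_add_le_max b (-1)
        simpa [h, ← sub_eq_add_neg] using this
      refine ⟨0, 0, fun k _ => ?_⟩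
      simp [aux_unit p hp hplt b h h2 k, h, h2]
  · refine ⟨0, 0, fun k _ => ?_⟩
    have h1 : ‖b ^ (p ^ k) - 1‖ = ‖b ^ (p ^ k)‖ := by
      apply aux_norm_eq
      simpa using one_lt_pow₀ h (hpk k)
    simp [h1, h.ne', max_eq_right h.le]

theorem aux_multiset [IsUltrametricDist K] (p : ℕ) (hp : p.Prime)
    (hpn : ‖(p : K)‖ = (p : ℝ)⁻¹) (s : Multiset K) (hs : ∀ b ∈ s, ¬ IsOfFinOrder b) :
    ∃ (k₀ : ℕ) (c : ℝ), ∀ k, k₀ ≤ k →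
      Real.log ‖(s.map (fun α => α ^ (p ^ k) - 1)).prod‖ =
      (p : ℝ) ^ k * Real.log (s.map (fun α => max 1 ‖α‖)).prod
        - (Multiset.card (s.filter (fun β => ‖β‖ = 1 ∧ ‖β - 1‖ < 1)) : ℝ)
          * (k * Real.log p) + c := by
  induction s using Multiset.induction_on with
  | empty => exact ⟨0, 0, by simp⟩
  | cons b s ih =>
    obtain ⟨k₁, c₁, h₁⟩ := ih fun b hb => hs b (Multiset.mem_cons_of_mem hb)
    obtain ⟨k₂, c₂, h₂⟩ := aux_root p hp hpn b (hs b (Multiset.mem_cons_self _ _))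
    refine ⟨max k₁ k₂, c₁ + c₂, fun k hk => ?_⟩
    have e₁ := h₁ k ((le_max_left _ _).trans hk)
    have e₂ := h₂ k ((le_max_right _ _).trans hk)
    have hne : ∀ a ∈ b ::ₘ s, a ^ (p ^ k) - 1 ≠ 0 := by
      intro a ha h
      exact hs a ha (isOfFinOrder_iff_pow_eq_one.2
        ⟨_, Nat.pos_of_ne_zero (pow_ne_zero k hp.ne_zero), sub_eq_zero.1 h⟩)
    have n1 : ‖b ^ (p ^ k) - 1‖ ≠ 0 := norm_ne_zero_iff.2 (hne b (Multiset.mem_cons_self _ _))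
    have n2 : ‖(s.map (fun α => α ^ (p ^ k) - 1)).prod‖ ≠ 0 := by
      rw [norm_ne_zero_iff]
      apply Multiset.prod_ne_zero
      rw [Multiset.mem_map]
      rintro ⟨a, ha, h⟩
      exact hne a (Multiset.mem_cons_of_mem ha) h
    have n3 : (max 1 ‖b‖) ≠ 0 := (lt_max_of_lt_left one_pos).ne'
    have n4 : (s.map (fun α => max 1 ‖α‖)).prod ≠ 0 := by
      apply Multiset.prod_ne_zero
      rw [Multiset.mem_map]
      rintro ⟨a, ha, h⟩
      exact (lt_max_of_lt_left one_pos).ne' h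
    rw [Multiset.map_cons, Multiset.prod_cons, norm_mul, Real.log_mul n1 n2, e₁, e₂,
      Multiset.map_cons, Multiset.prod_cons, Real.log_mul n3 n4]
    by_cases hc : ‖b‖ = 1 ∧ ‖b - 1‖ < 1
    · rw [Multiset.filter_cons_of_pos (p := fun β : K => ‖β‖ = 1 ∧ ‖β - 1‖ < 1) s hc, if_pos hc, Multiset.card_cons]
      push_cast
      ring
    · rw [Multiset.filter_cons_of_neg (p := fun β : K => ‖β‖ = 1 ∧ ‖β - 1‖ < 1) s hc, if_neg hc]
      ring

theorem aux_gauss_linear (b : K) :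
    (X - C b).gaussNorm (NormedField.toAbsoluteValue K) 1 = max 1 ‖b‖ := by
  apply le_antisymm
  · obtain ⟨i, hi⟩ := (X - C b).exists_eq_gaussNorm (NormedField.toAbsoluteValue K) 1
    rw [hi]
    match i with
    | 0 => simp [NormedField.toAbsoluteValue]
    | 1 => simp [NormedField.toAbsoluteValue, coeff_C]
    | (i + 2) => simp [NormedField.toAbsoluteValue, coeff_C, coeff_X]
  · have h0 := (X - C b).le_gaussNorm (NormedField.toAbsoluteValue K) zero_le_one 0
    have h1 := (X - C b).le_gaussNorm (NormedField.toAbsoluteValue K) zero_le_one 1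
    simp [NormedField.toAbsoluteValue, coeff_C] at h0 h1
    exact max_le h1 h0

theorem aux_gauss [IsUltrametricDist K] (g : K[X]) (hg : g.Splits) :
    ∃ i, ‖g.leadingCoeff‖ * (g.roots.map (fun α => max 1 ‖α‖)).prod = ‖g.coeff i‖ := by
  have hna : IsNonarchimedean (NormedField.toAbsoluteValue K) :=
    IsUltrametricDist.isNonarchimedean_norm
  have key : ∀ s : Multiset K,
      ((s.map (fun a => X - C a)).prod).gaussNorm (NormedField.toAbsoluteValue K) 1 =
        (s.map (fun α => max 1 ‖α‖)).prod := by
    intro s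
    induction s using Multiset.induction_on with
    | empty =>
      have := gaussNorm_C (NormedField.toAbsoluteValue K) 1 (1 : K)
      simpa using this
    | cons b s ih =>
      rw [Multiset.map_cons, Multiset.prod_cons, gaussNorm_mul hna one_pos, ih,
        aux_gauss_linear, Multiset.map_cons, Multiset.prod_cons]
  obtain ⟨i, hi⟩ := g.exists_eq_gaussNorm (NormedField.toAbsoluteValue K) 1
  refine ⟨i, ?_⟩
  rw [one_pow, mul_one] at hi
  refine Eq.trans ?_ hi
  conv_rhs => rw [hg.eq_prod_roots]
  rw [gaussNorm_mul hna one_pos, key, gaussNorm_C]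
  rfl

end aux

/-- for `f ∈ ℤ[t]` nonzero and not vanishing at roots of unity, there are
`k₀ ∈ ℕ` and `ν ∈ ℤ` with `ord_p(Δ_{p^k}(f)) = μ_p(f)·p^k + λ_p(f)·k + ν` for all `k ≥ k₀`,
where `μ_p(f) = -m_p(f)/log p` and `λ_p(f) = #{j : |β_j|_p = 1, |β_j - 1|_p < 1}`. -/
theorem ordp_pierceLehmer_p_pow_tower
    (p : ℕ) [Fact p.Prime]
    (K : Type*) [NormedField K] [Algebra ℚ_[p] K] [IsAlgClosure ℚ_[p] K]
    (hext : ∀ x : ℚ_[p], ‖algebraMap ℚ_[p] K x‖ = ‖x‖)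
    (f : Polynomial ℤ) (hf : f ≠ 0)
    (hru : ∀ ζ : K, IsOfFinOrder ζ → (f.map (Int.castRingHom K)).eval ζ ≠ 0) :
    ∃ (k₀ : ℕ) (ν : ℤ), ∀ k : ℕ, k₀ ≤ k →
      ordp p (pierceLehmer K f (p ^ k)) =
        (-(Real.log (mahlerMeasure K f)) / Real.log p) * ((p : ℝ) ^ k) +
        (Multiset.card (((f.map (Int.castRingHom K)).roots).filter
            (fun β => ‖β‖ = 1 ∧ ‖β - 1‖ < 1)) : ℝ) * (k : ℝ) +
        (ν : ℝ) := by

  have hp : p.Prime := Fact.out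
  have hp1 : (1 : ℝ) < p := by exact_mod_cast hp.one_lt
  have hlp : Real.log p ≠ 0 := (Real.log_pos hp1).ne'
  have hint : ∀ n : ℤ, ‖(n : K)‖ = ‖(n : ℚ_[p])‖ := fun n => by
    rw [← hext, map_intCast]
  have hpn : ‖(p : K)‖ = (p : ℝ)⁻¹ := by
    rw [← Padic.norm_p (p := p), ← hext, map_natCast]
  have : IsUltrametricDist K :=
    IsUltrametricDist.isUltrametricDist_of_forall_norm_natCast_le_one fun n => by
      have := hint n
      simp only [Int.cast_natCast] at this
      rw [this]
      exact IsUltrametricDist.norm_natCast_le_one _ _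
  have : IsAlgClosed K := IsAlgClosure.isAlgClosed ℚ_[p]
  have : CharZero K := charZero_of_injective_algebraMap (algebraMap ℚ_[p] K).injective
  -- integrality
  have hord : ∀ n : ℤ, n ≠ 0 → ∃ m : ℤ, Real.log ‖(n : K)‖ = m * Real.log p := by
    intro n hn
    have hn' : (n : ℚ_[p]) ≠ 0 := by exact_mod_cast hn
    refine ⟨-(n : ℚ_[p]).valuation, ?_⟩
    rw [hint, Padic.norm_eq_zpow_neg_valuation hn', Real.log_zpow]
  set g := f.map (Int.castRingHom K) with hg
  have hg0 : g ≠ 0 := (Polynomial.map_ne_zero_iff (RingHom.injective_int _)).2 hf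
  have hgs : g.Splits := IsAlgClosed.splits g
  have hs : ∀ b ∈ g.roots, ¬ IsOfFinOrder b := fun b hb hb' =>
    hru b hb' (isRoot_of_mem_roots hb)
  have hM0 : (g.roots.map (fun α => max 1 ‖α‖)).prod ≠ 0 := by
    apply Multiset.prod_ne_zero
    rw [Multiset.mem_map]
    rintro ⟨a, ha, h⟩
    exact (lt_max_of_lt_left one_pos).ne' h
  have hl0 : ‖g.leadingCoeff‖ ≠ 0 := by simpa using hg0
  have hM : ∃ m : ℤ, Real.log (_root_.mahlerMeasure K f) = m * Real.log p := by
    obtain ⟨i, hi⟩ := aux_gauss g hgs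
    have e : _root_.mahlerMeasure K f = ‖((f.coeff i : ℤ) : K)‖ := by
      rw [_root_.mahlerMeasure, ← hg, hi, hg, coeff_map]
      rfl
    have hne : f.coeff i ≠ 0 := by
      intro h
      have : _root_.mahlerMeasure K f ≠ 0 := mul_ne_zero hl0 hM0
      apply this
      rw [e, h]; simp
    rw [e]
    exact hord _ hne
  have hP0 : ∀ k, (g.roots.map (fun α => α ^ (p ^ k) - 1)).prod ≠ 0 := by
    intro k
    apply Multiset.prod_ne_zero
    rw [Multiset.mem_map]
    rintro ⟨a, ha, h⟩
    exact hs a ha (isOfFinOrder_iff_pow_eq_one.2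
      ⟨_, Nat.pos_of_ne_zero (pow_ne_zero k hp.ne_zero), sub_eq_zero.1 h⟩)
  have hD : ∀ k, ∃ m : ℤ, Real.log ‖pierceLehmer K f (p ^ k)‖ = m * Real.log p := by
    intro k
    have h1 := resultant_eq_prod_eval g (X ^ (p ^ k) - 1 : K[X]) (p ^ k)
      (by rw [← C_1, natDegree_X_pow_sub_C]) hgs
    have h2 : (X ^ (p ^ k) - 1 : K[X]) = (X ^ (p ^ k) - 1 : ℤ[X]).map (Int.castRingHom K) := by
      simp
    have h3 : pierceLehmer K f (p ^ k) =
        ((resultant f (X ^ (p ^ k) - 1) g.natDegree (p ^ k) : ℤ) : K) := by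
      have h4 := resultant_map_map f (X ^ (p ^ k) - 1 : ℤ[X]) g.natDegree (p ^ k)
        (Int.castRingHom K)
      rw [← h2, ← hg, h1] at h4
      simpa [pierceLehmer, ← hg] using h4
    rw [h3]
    apply hord
    intro h
    rw [h, Int.cast_zero] at h3
    exact mul_ne_zero (pow_ne_zero _ (norm_ne_zero_iff.1 hl0)) (hP0 k) h3
  obtain ⟨k₀, c, hk⟩ := aux_multiset p hp hpn g.roots hs
  have hmain : ∀ k, k₀ ≤ k → Real.log ‖pierceLehmer K f (p ^ k)‖ =
      (p : ℝ) ^ k * Real.log (_root_.mahlerMeasure K f)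
        - (Multiset.card (g.roots.filter (fun β => ‖β‖ = 1 ∧ ‖β - 1‖ < 1)) : ℝ)
          * (k * Real.log p) + c := by
    intro k hkk
    rw [pierceLehmer, _root_.mahlerMeasure, ← hg, norm_mul, norm_pow,
      Real.log_mul (pow_ne_zero _ hl0) (norm_ne_zero_iff.2 (hP0 k)), hk k hkk,
      Real.log_mul hl0 hM0, Real.log_pow]
    push_cast
    ring
  obtain ⟨m, hm⟩ := hM
  obtain ⟨n, hn⟩ := hD k₀
  set L := Multiset.card (g.roots.filter (fun β => ‖β‖ = 1 ∧ ‖β - 1‖ < 1)) with hL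
  have hc : c = (n - (p : ℝ) ^ k₀ * m + L * k₀) * Real.log p := by
    have := hmain k₀ le_rfl
    rw [hn, hm] at this
    linarith
  refine ⟨k₀, -(n - (p : ℤ) ^ k₀ * m + L * k₀), fun k hkk => ?_⟩
  rw [ordp, hmain k hkk, hm, hc]
  push_cast
  field_simp
  ring
end

section
/- Let f ∈ ℤ[t] be a nonzero polynomial which does not vanish at any root of unity. Then |Δ_n(f)|^{1/n} → M_∞(f) as n → ∞. -/
open Polynomial Filter

theorem PL_liouville (α : ℂ) (hα : IsAlgebraic ℚ α) : ∃ C : ℝ, 1 ≤ C ∧ ∃ d : ℕ,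
    ∀ (D : ℤ[X]) (M : ℕ) (H : ℝ), 1 ≤ H → D.natDegree ≤ M →
      (∀ z : ℂ, ‖aeval z D‖ ≤ H * (max 1 ‖z‖) ^ M) → aeval α D ≠ 0 →
      1 ≤ ‖aeval α D‖ * (H * C ^ M) ^ d := by
  classical
  have hintg : IsIntegral ℚ α := hα.isIntegral
  have : FiniteDimensional ℚ (IntermediateField.adjoin ℚ {α}) :=
    IntermediateField.adjoin.finiteDimensional hintg
  set K := IntermediateField.adjoin ℚ {α} with hK
  let x : K := IntermediateField.AdjoinSimple.gen ℚ α
  have hx : (algebraMap K ℂ) x = α := IntermediateField.AdjoinSimple.algebraMap_gen ℚ α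
  have hxalg : IsAlgebraic ℤ x := by
    have : IsAlgebraic ℚ x := Algebra.IsAlgebraic.isAlgebraic x
    exact (IsFractionRing.isAlgebraic_iff ℤ ℚ K).mpr this
  obtain ⟨a, ha0, ha⟩ := hxalg.exists_integral_multiple
  let S : Finset (K →ₐ[ℚ] ℂ) := Finset.univ
  let C : ℝ := |(a : ℝ)| * ∏ σ : K →ₐ[ℚ] ℂ, max 1 ‖σ x‖
  have ha1 : (1 : ℝ) ≤ |(a : ℝ)| := by
    exact_mod_cast Int.one_le_abs ha0
  have hP1 : ∀ σ : K →ₐ[ℚ] ℂ, (1 : ℝ) ≤ max 1 ‖σ x‖ := fun σ => le_max_left _ _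
  have hP : (1 : ℝ) ≤ ∏ σ : K →ₐ[ℚ] ℂ, max 1 ‖σ x‖ := by
    calc (1 : ℝ) = ∏ _σ : K →ₐ[ℚ] ℂ, (1 : ℝ) := by simp
      _ ≤ _ := Finset.prod_le_prod (fun _ _ => zero_le_one) (fun σ _ => hP1 σ)
  have hC : ∀ σ : K →ₐ[ℚ] ℂ, |(a : ℝ)| * max 1 ‖σ x‖ ≤ C := by
    intro σ
    refine mul_le_mul_of_nonneg_left ?_ (by positivity)
    rw [← Finset.mul_prod_erase Finset.univ _ (Finset.mem_univ σ)]
    refine le_mul_of_one_le_right (by positivity) ?_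
    calc (1 : ℝ) = ∏ _σ ∈ Finset.univ.erase σ, (1 : ℝ) := by simp
      _ ≤ _ := Finset.prod_le_prod (fun _ _ => zero_le_one) (fun σ _ => hP1 σ)
  have haC : |(a : ℝ)| ≤ C := le_mul_of_one_le_right (by positivity) hP
  have hC1 : 1 ≤ C := ha1.trans haC
  refine ⟨C, hC1, Fintype.card (K →ₐ[ℚ] ℂ), ?_⟩
  intro D M H hH hD hbd hne
  let y : K := (a : K) ^ M * aeval x D
  have hyint : IsIntegral ℤ y := by
    have : y = ∑ i ∈ Finset.range (M + 1), ((D.coeff i * a ^ (M - i) : ℤ) : K) * (a • x) ^ i := by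
      simp only [y]
      rw [aeval_eq_sum_range' (Nat.lt_succ_of_le hD), Finset.mul_sum]
      refine Finset.sum_congr rfl fun i hi => ?_
      have hi' : i ≤ M := Nat.lt_succ_iff.mp (Finset.mem_range.mp hi)
      obtain ⟨j, rfl⟩ := Nat.exists_eq_add_of_le hi'
      simp only [zsmul_eq_mul, Nat.add_sub_cancel_left]
      push_cast
      ring
    rw [this]
    exact IsIntegral.sum _ fun i _ => (isIntegral_algebraMap (R := ℤ) (A := K)
      (x := (D.coeff i * a ^ (M - i) : ℤ))).mul (ha.pow i)
  have hσD : ∀ σ : K →ₐ[ℚ] ℂ, σ (aeval x D) = aeval (σ x) D := by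
    intro σ
    exact (Polynomial.aeval_algHom_apply (σ.restrictScalars ℤ) x D).symm
  have hσy : ∀ σ : K →ₐ[ℚ] ℂ, ‖σ y‖ = |(a : ℝ)| ^ M * ‖aeval (σ x) D‖ := by
    intro σ
    simp only [y, map_mul, map_pow, hσD, map_intCast, norm_mul, norm_pow, Complex.norm_intCast]
  let σ0 : K →ₐ[ℚ] ℂ := IntermediateField.val K
  have hσ0 : σ0 x = α := hx
  have hy0 : y ≠ 0 := by
    intro h
    have := hσy σ0
    rw [h, map_zero, norm_zero, hσ0] at this
    have h2 : ‖aeval α D‖ ≠ 0 := norm_ne_zero_iff.mpr hne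
    have : |(a : ℝ)| ^ M * ‖aeval α D‖ ≠ 0 := by positivity
    simp_all
  have hnorm : (1 : ℝ) ≤ ∏ σ : K →ₐ[ℚ] ℂ, ‖σ y‖ := by
    have h1 := Algebra.norm_eq_prod_embeddings ℚ ℂ y
    have h2 : IsIntegral ℤ (Algebra.norm ℚ y) := Algebra.isIntegral_norm ℚ hyint
    obtain ⟨b, hb⟩ := IsIntegrallyClosed.isIntegral_iff.mp h2
    have h3 : Algebra.norm ℚ y ≠ 0 := Algebra.norm_ne_zero_iff.mpr hy0
    have hb0 : b ≠ 0 := by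
      rintro rfl
      apply h3; rw [← hb]; simp
    rw [← norm_prod, ← h1, ← hb]
    simp only [algebraMap_int_eq, eq_intCast, map_intCast, Complex.norm_intCast]
    exact_mod_cast Int.one_le_abs hb0
  have hB1 : 1 ≤ H * C ^ M := one_le_mul_of_one_le_of_one_le hH (one_le_pow₀ hC1)
  have hle : ∀ σ : K →ₐ[ℚ] ℂ, ‖σ y‖ ≤ H * C ^ M := by
    intro σ
    rw [hσy]
    calc |(a : ℝ)| ^ M * ‖aeval (σ x) D‖ ≤ |(a : ℝ)| ^ M * (H * (max 1 ‖σ x‖) ^ M) := by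
          gcongr; exact hbd _
      _ = H * (|(a : ℝ)| * max 1 ‖σ x‖) ^ M := by rw [mul_pow]; ring
      _ ≤ H * C ^ M := by gcongr; exact hC σ
  have hle0 : ‖σ0 y‖ ≤ ‖aeval α D‖ * (H * C ^ M) := by
    rw [hσy, hσ0, mul_comm]
    gcongr
    calc |(a : ℝ)| ^ M ≤ C ^ M := by gcongr
      _ ≤ H * C ^ M := le_mul_of_one_le_left (by positivity) hH
  rw [← Finset.mul_prod_erase Finset.univ _ (Finset.mem_univ σ0)] at hnorm
  have hcard : 0 < Fintype.card (K →ₐ[ℚ] ℂ) := Fintype.card_pos_iff.mpr ⟨σ0⟩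
  calc (1 : ℝ) ≤ _ := hnorm
    _ ≤ (‖aeval α D‖ * (H * C ^ M)) * (H * C ^ M) ^ (Fintype.card (K →ₐ[ℚ] ℂ) - 1) := by
        refine mul_le_mul hle0 ?_ (Finset.prod_nonneg fun _ _ => norm_nonneg _) (by positivity)
        refine (Finset.prod_le_prod (fun _ _ => norm_nonneg _) (fun σ _ => hle σ)).trans ?_
        rw [Finset.prod_const, Finset.card_erase_of_mem (Finset.mem_univ _), Finset.card_univ]
    _ = _ := by
        rw [mul_assoc, ← pow_succ', Nat.sub_add_cancel hcard]

theorem PL_perturb (D : ℤ[X]) (M : ℕ) (H : ℝ) (hH : 0 ≤ H)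
    (hbd : ∀ z : ℂ, ‖aeval z D‖ ≤ H * (max 1 ‖z‖) ^ M) (u v : ℂ) (hu : ‖u‖ ≤ 1) (hv : ‖v‖ ≤ 1) :
    ‖aeval u D - aeval v D‖ ≤ H * 2 ^ M * ‖u - v‖ := by
  have hdiff : Differentiable ℂ (fun z : ℂ => aeval z D) := Polynomial.differentiable_aeval D
  refine Convex.norm_image_sub_le_of_norm_deriv_le (𝕜 := ℂ) (f := fun z : ℂ => aeval z D)
    (s := Metric.closedBall 0 1) (fun x _ => hdiff x) ?_ (convex_closedBall 0 1)
    (by simpa using hv) (by simpa using hu)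
  intro x hx
  have hx' : ‖x‖ ≤ 1 := by simpa using hx
  have := Complex.norm_deriv_le_of_forall_mem_sphere_norm_le (c := x) (R := 1) (C := H * 2 ^ M)
    (f := fun z : ℂ => aeval z D) one_pos hdiff.diffContOnCl ?_
  · simpa using this
  · intro z hz
    refine (hbd z).trans ?_
    have : ‖z‖ ≤ 2 := by
      have h1 : ‖z - x‖ = 1 := by simpa [dist_eq_norm] using hz
      calc ‖z‖ = ‖(z - x) + x‖ := by ring_nf
        _ ≤ ‖z - x‖ + ‖x‖ := norm_add_le _ _
        _ ≤ 2 := by linarith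
    have : max 1 ‖z‖ ≤ 2 := max_le (by norm_num) this
    gcongr

theorem PL_minor {m n : Type*} [Fintype m] [Fintype n] [DecidableEq n] (A : Matrix m n ℂ)
    (h : ∀ p : n → ℂ, A.mulVec p = 0 → p = 0) :
    ∃ e : n → m, (A.submatrix e id).det ≠ 0 := by
  classical
  have hrank : A.rank = Fintype.card n := by
    have hinj : Function.Injective A.mulVecLin := by
      rw [← LinearMap.ker_eq_bot, LinearMap.ker_eq_bot']
      intro p hp; exact h p hp
    rw [Matrix.rank, LinearMap.finrank_range_of_inj hinj, Module.finrank_fintype_fun_eq_card]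
  obtain ⟨κ, a, hainj, hspan, hli⟩ := exists_linearIndependent' ℂ A.row
  have : Finite κ := Finite.of_injective a hainj
  have : Fintype κ := Fintype.ofFinite κ
  have hcard : Fintype.card κ = Fintype.card n := by
    rw [← finrank_span_eq_card hli, hspan, ← Matrix.rank_eq_finrank_span_row, hrank]
  let e := Fintype.equivOfCardEq hcard.symm
  refine ⟨a ∘ e, ?_⟩
  have : LinearIndependent ℂ (A.submatrix (a ∘ e) id).row := by
    exact hli.comp e e.injective
  have := Matrix.linearIndependent_rows_iff_isUnit.mp this
  exact ((Matrix.isUnit_iff_isUnit_det _).mp this).ne_zero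

theorem PL_sum_inj {ι : Type*} [Fintype ι] (f : ι → ℕ) (hf : Function.Injective f) :
    Fintype.card ι * (Fintype.card ι - 1) / 2 ≤ ∑ i, f i := by
  classical
  have key : ∀ s : Finset ℕ, ∑ i ∈ Finset.range s.card, i ≤ ∑ i ∈ s, i := by
    intro s
    induction s using Finset.induction_on_max with
    | empty => simp
    | insert a s hs ih =>
      have ha : a ∉ s := fun h => lt_irrefl _ (hs a h)
      rw [Finset.card_insert_of_notMem ha, Finset.sum_range_succ, Finset.sum_insert ha, add_comm]
      have : s.card ≤ a := by
        have : s ⊆ Finset.range a := fun x hx => Finset.mem_range.mpr (hs x hx)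
        simpa using Finset.card_le_card this
      omega
  have := key (Finset.univ.image f)
  rw [Finset.card_image_of_injective _ hf, Finset.card_univ, Finset.sum_range_id,
    Finset.sum_image (fun _ _ _ _ h => hf h)] at this
  exact this

theorem PL_det_row_le {ι : Type*} [Fintype ι] [DecidableEq ι] (M : Matrix ι ι ℂ) (b : ι → ℝ)
    (h : ∀ i j, ‖M i j‖ ≤ b i) : ‖M.det‖ ≤ (Fintype.card ι).factorial * ∏ i, b i := by
  rw [Matrix.det_apply']
  refine (norm_sum_le _ _).trans ?_
  have : ∀ σ ∈ (Finset.univ : Finset (Equiv.Perm ι)),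
      ‖((Equiv.Perm.sign σ : ℤ) : ℂ) * ∏ i, M (σ i) i‖ ≤ ∏ i, b i := by
    intro σ _
    rw [norm_mul, norm_prod, ← Equiv.prod_comp σ b]
    have h1 : ‖((Equiv.Perm.sign σ : ℤ) : ℂ)‖ = 1 := by
      rcases Int.units_eq_one_or (Equiv.Perm.sign σ) with h | h <;> simp [h]
    rw [h1, one_mul]
    exact Finset.prod_le_prod (fun _ _ => norm_nonneg _) fun i _ => h _ _
  refine (Finset.sum_le_card_nsmul _ _ _ this).trans ?_
  rw [Finset.card_univ, Fintype.card_perm, nsmul_eq_mul]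

theorem PL_det_upper {ι : Type*} [Fintype ι] [DecidableEq ι] (x : ι → ℝ) (X : ℝ) (hX1 : 1 ≤ X)
    (hx : ∀ i, 0 ≤ x i) (hxX : ∀ i, x i ≤ X) (t r : ι → ℕ) (T : ℕ) (ht : ∀ i, t i ≤ T)
    (c : ℂ) (Y : ℝ) (hY : ∀ i, ‖c‖ * r i * X ≤ Y) (E : ℝ) (hE : 1 ≤ E) :
    ‖(Matrix.of fun i j : ι => (x j : ℂ) ^ (t i) * Complex.exp (c * r i * x j)).det‖
      * E ^ (Fintype.card ι * (Fintype.card ι - 1) / 2) ≤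
    (Fintype.card ι).factorial * ((X * E) ^ T * Real.exp (Y * E)) ^ (Fintype.card ι) := by
  set N := Fintype.card ι
  let a : ι → ℕ → ℂ := fun i j => (c * r i) ^ j / (j.factorial : ℂ)
  let w : ℕ → ι → ℂ := fun e j => (x j : ℂ) ^ e
  let A : ℕ → Matrix ι ι ℂ := fun J => fun i => ∑ j ∈ Finset.range J, a i j • w (j + t i)
  have hlim : Tendsto (fun J => ‖(A J).det‖ * E ^ (N * (N - 1) / 2)) atTop
      (nhds (‖(Matrix.of fun i j : ι => (x j : ℂ) ^ (t i) * Complex.exp (c * r i * x j)).det‖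
      * E ^ (N * (N - 1) / 2))) := by
    refine Tendsto.mul_const _ (Tendsto.norm ?_)
    have hc : Continuous (fun M : Matrix ι ι ℂ => M.det) := Continuous.matrix_det continuous_id
    refine (hc.tendsto _).comp ?_
    refine tendsto_pi_nhds.mpr fun i => tendsto_pi_nhds.mpr fun k => ?_
    have h1 : HasSum (fun j : ℕ => (c * r i * x k) ^ j / (j.factorial : ℂ))
        (Complex.exp (c * r i * x k)) := by
      rw [Complex.exp_eq_exp_ℂ]
      exact NormedSpace.expSeries_div_hasSum_exp (c * r i * x k)
    have h2 := (h1.mul_left ((x k : ℂ) ^ (t i))).tendsto_sum_nat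
    refine h2.congr fun J => ?_
    simp only [A, Finset.sum_apply, Pi.smul_apply, a, w, smul_eq_mul]
    refine Finset.sum_congr rfl fun j _ => ?_
    rw [mul_pow _ ((x k : ℂ)), pow_add]; ring
  refine le_of_tendsto hlim (Eventually.of_forall fun J => ?_)
  have hexp : (A J).det = ∑ σ ∈ Fintype.piFinset (fun _ : ι => Finset.range J),
      (∏ i, a i (σ i)) * (Matrix.of fun i => w (σ i + t i)).det := by
    have h1 := (Matrix.detRowAlternating (R := ℂ) (n := ι)).toMultilinearMap.map_sum_finset
      (fun i j => a i j • w (j + t i)) (fun _ => Finset.range J)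
    refine h1.trans (Finset.sum_congr rfl fun σ _ => ?_)
    exact (Matrix.detRowAlternating (R := ℂ) (n := ι)).toMultilinearMap.map_smul_univ
      (fun i => a i (σ i)) (fun i => w (σ i + t i))
  have hterm : ∀ σ : ι → ℕ, ‖(∏ i, a i (σ i)) * (Matrix.of fun i => w (σ i + t i)).det‖
      * E ^ (N * (N - 1) / 2) ≤ N.factorial * ∏ i, (‖a i (σ i)‖ * (X * E) ^ (σ i + t i)) := by
    intro σ
    by_cases hinj : Function.Injective (fun i => σ i + t i)
    · have h1 : ‖(Matrix.of fun i => w (σ i + t i)).det‖ ≤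
          N.factorial * ∏ i, X ^ (σ i + t i) := by
        refine PL_det_row_le _ _ fun i j => ?_
        simp only [Matrix.of_apply, w, norm_pow, Complex.norm_real, Real.norm_eq_abs,
          abs_of_nonneg (hx j)]
        exact pow_le_pow_left₀ (hx j) (hxX j) _
      have h2 : E ^ (N * (N - 1) / 2) ≤ ∏ i, E ^ (σ i + t i) := by
        rw [Finset.prod_pow_eq_pow_sum]
        exact pow_le_pow_right₀ hE (PL_sum_inj _ hinj)
      rw [norm_mul, norm_prod, Finset.prod_mul_distrib]
      simp only [mul_pow, Finset.prod_mul_distrib]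
      have h3 : 0 ≤ ∏ i, ‖a i (σ i)‖ := Finset.prod_nonneg fun _ _ => norm_nonneg _
      have h4 : 0 ≤ ∏ i, X ^ (σ i + t i) := Finset.prod_nonneg fun _ _ => by positivity
      calc _ ≤ (∏ i, ‖a i (σ i)‖) * (N.factorial * ∏ i, X ^ (σ i + t i)) *
            ∏ i, E ^ (σ i + t i) := by gcongr
        _ = _ := by ring
    · have : (Matrix.of fun i => w (σ i + t i)).det = 0 := by
        simp only [Function.Injective, not_forall] at hinj
        obtain ⟨i, j, hij, hne⟩ := hinj
        refine Matrix.det_zero_of_row_eq hne ?_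
        funext k
        simp only [Matrix.of_apply, hij]
      rw [this, mul_zero, norm_zero, zero_mul]
      positivity
  calc ‖(A J).det‖ * E ^ (N * (N - 1) / 2)
      ≤ (∑ σ ∈ Fintype.piFinset (fun _ : ι => Finset.range J),
          ‖(∏ i, a i (σ i)) * (Matrix.of fun i => w (σ i + t i)).det‖) * E ^ (N * (N - 1) / 2) := by
        rw [hexp]; gcongr; exact norm_sum_le _ _
    _ ≤ ∑ σ ∈ Fintype.piFinset (fun _ : ι => Finset.range J),
          N.factorial * ∏ i, (‖a i (σ i)‖ * (X * E) ^ (σ i + t i)) := by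
        rw [Finset.sum_mul]; exact Finset.sum_le_sum fun σ _ => hterm σ
    _ = N.factorial * ∏ i, ∑ j ∈ Finset.range J, (‖a i j‖ * (X * E) ^ (j + t i)) := by
        rw [← Finset.mul_sum, Finset.prod_univ_sum]
    _ ≤ N.factorial * ∏ _i : ι, ((X * E) ^ T * Real.exp (Y * E)) := by
        gcongr with i
        have hXE : 1 ≤ X * E := one_le_mul_of_one_le_of_one_le hX1 hE
        have h1 : ∑ j ∈ Finset.range J, (‖a i j‖ * (X * E) ^ (j + t i)) =
            (X * E) ^ (t i) * ∑ j ∈ Finset.range J, (‖c‖ * r i * X * E) ^ j / j.factorial := by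
          rw [Finset.mul_sum]
          refine Finset.sum_congr rfl fun j _ => ?_
          simp only [a, norm_div, norm_pow, norm_mul, Complex.norm_natCast]
          rw [pow_add, mul_assoc _ X E, mul_pow _ (X * E)]; ring
        rw [h1]
        have h2 := Real.sum_le_exp_of_nonneg (x := ‖c‖ * r i * X * E) (by positivity) J
        have h3 : ‖c‖ * r i * X * E ≤ Y * E := by gcongr; exact hY i
        refine mul_le_mul (pow_le_pow_right₀ hXE (ht i)) (h2.trans (Real.exp_le_exp.mpr h3))
          (Finset.sum_nonneg fun _ _ => by positivity) (by positivity)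
    _ = _ := by rw [Finset.prod_const, Finset.card_univ]

theorem PL_dvd_chain (G : ℕ → ℂ[X]) (T : ℕ) (hG : ∀ t, X * derivative (G t) = G (t + 1))
    (h1 : ∀ t < T, (G t).eval 1 = 0) :
    ∀ a t, t + a ≤ T → (X - C 1) ^ a ∣ G t := by
  intro a
  induction a with
  | zero => intro t _; simp
  | succ a ih =>
    intro t ht
    have hd : (X - C 1) ^ a ∣ X * derivative (G t) := by
      rw [hG]; exact ih (t + 1) (by omega)
    have hcop : IsCoprime ((X - C 1 : ℂ[X]) ^ a) X := by
      refine IsCoprime.pow_left ⟨-1, 1, by simp⟩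
    have hd' := hcop.dvd_of_dvd_mul_left hd
    by_cases h0 : G t = 0
    · rw [h0]; exact dvd_zero _
    have hroot : (G t).IsRoot 1 := h1 t (by omega)
    have hpos : 0 < rootMultiplicity 1 (G t) := (rootMultiplicity_pos h0).mpr hroot
    have hder := derivative_rootMultiplicity_of_root hroot
    rw [← le_rootMultiplicity_iff h0]
    have hder0 : derivative (G t) ≠ 0 := by
      intro h
      have hc := Polynomial.derivative_eq_zero.mp h
      rw [Polynomial.eq_C_of_natDegree_eq_zero hc] at hroot h0
      simp only [IsRoot, eval_C] at hroot
      rw [hroot] at h0; simp at h0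
    have := (le_rootMultiplicity_iff hder0).mpr hd'
    omega

theorem PL_mult_comp (W : ℂ[X]) (hW : W ≠ 0) (β : ℂ) (hβ : β ≠ 0) (m : ℕ) (hm : m ≠ 0) (s : ℕ)
    (h : (X - C 1) ^ s ∣ W.comp (C β * X ^ m)) : (X - C β) ^ s ∣ W := by
  obtain ⟨V, hV, hnd⟩ := exists_eq_pow_rootMultiplicity_mul_and_not_dvd W hW β
  rw [← le_rootMultiplicity_iff hW]
  set q := rootMultiplicity β W
  by_contra hlt
  push Not at hlt
  have hfac : W.comp (C β * X ^ m) =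
      (X - C 1) ^ q * ((C β * ∑ i ∈ Finset.range m, X ^ i) ^ q * V.comp (C β * X ^ m)) := by
    conv_lhs => rw [hV]
    rw [mul_comp, pow_comp, sub_comp, X_comp, C_comp, ← mul_assoc, ← mul_pow]
    congr 2
    have := mul_geom_sum (X : ℂ[X]) m
    rw [C_1]
    linear_combination (- C β) * this
  rw [hfac] at h
  have h2 : (X - C 1) ^ (q + 1) ∣ (X - C (1 : ℂ)) ^ q *
      ((C β * ∑ i ∈ Finset.range m, X ^ i) ^ q * V.comp (C β * X ^ m)) :=
    (pow_dvd_pow _ hlt).trans h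
  rw [pow_succ] at h2
  have h3 := (mul_dvd_mul_iff_left (pow_ne_zero q (X_sub_C_ne_zero (1 : ℂ)))).mp h2
  rw [dvd_iff_isRoot] at h3
  simp only [IsRoot, eval_mul, eval_pow, eval_C, eval_finsetSum, eval_X, one_pow, eval_comp,
    Finset.sum_const, Finset.card_range, nsmul_eq_mul, mul_one] at h3
  rcases mul_eq_zero.mp h3 with h4 | h4
  · have h5 : β * (m : ℂ) ≠ 0 := mul_ne_zero hβ (by exact_mod_cast hm)
    exact pow_ne_zero q h5 h4
  · exact hnd (dvd_iff_isRoot.mpr h4)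

theorem PL_coeff_det {s : ℕ} (L : ℕ) (M : Matrix (Fin s) (Fin s) ℂ[X])
    (h : ∀ i j, (M i j).natDegree ≤ L) :
    M.det.natDegree ≤ s * L ∧ M.det.coeff (s * L) = (M.map fun q => q.coeff L).det := by
  constructor
  · rw [Matrix.det_apply]
    refine natDegree_sum_le_of_forall_le _ _ fun σ _ => ?_
    refine (natDegree_smul_le _ _).trans ?_
    refine (natDegree_prod_le _ _).trans ?_
    refine (Finset.sum_le_card_nsmul _ _ L fun i _ => h _ _).trans ?_
    simp
  · rw [Matrix.det_apply, Matrix.det_apply, finsetSum_coeff]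
    refine Finset.sum_congr rfl fun σ _ => ?_
    rw [coeff_smul]
    congr 1
    have := coeff_prod_of_natDegree_le (s := (Finset.univ : Finset (Fin s)))
      (f := fun i => M (σ i) i) L (fun i _ => h _ _)
    simpa using this

theorem PL_zero_est (K L T R n m : ℕ) (hm : m ≠ 0) (α : ℂ) (hα0 : α ≠ 0)
    (hinj : ∀ r < R, ∀ r' < R, α ^ r = α ^ r' → r = r')
    (hx : ∀ k l k' l' : ℕ, l < L → l' < L → k * n + l * m = k' * n + l' * m → k = k')
    (hT : K * L < R * (T + 1 - K)) (hKT : K ≤ T)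
    (p : Fin K × Fin L → ℂ)
    (h : ∀ t < T, ∀ r < R, ∑ q : Fin K × Fin L,
      (((q.1 : ℕ) * n + (q.2 : ℕ) * m : ℕ) : ℂ) ^ t * (α ^ r) ^ (q.2 : ℕ) * p q = 0) : p = 0 := by
  classical
  by_contra hp
  let xx : Fin K → Fin L → ℕ := fun k l => (k : ℕ) * n + (l : ℕ) * m
  let PP : Fin K → ℕ → ℂ[X] := fun k j => ∑ l : Fin L, C (p (k, l) * (xx k l : ℂ) ^ j) * X ^ (l : ℕ)
  have hPPdeg : ∀ k j, ∀ e, (PP k j).coeff e =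
      if he : e < L then p (k, ⟨e, he⟩) * (xx k ⟨e, he⟩ : ℂ) ^ j else 0 := by
    intro k j e
    simp only [PP, finsetSum_coeff, coeff_C_mul, coeff_X_pow]
    split_ifs with he
    · rw [Finset.sum_eq_single (⟨e, he⟩ : Fin L)]
      · simp
      · intro b _ hb
        have : e ≠ (b : ℕ) := fun h => hb (Fin.ext h.symm)
        simp [this]
      · simp
    · refine Finset.sum_eq_zero fun b _ => ?_
      have : e ≠ (b : ℕ) := by have := b.2; omega
      simp [this]
  -- the nonzero indices
  let S : Finset (Fin K) := Finset.univ.filter fun k => PP k 0 ≠ 0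
  have hSne : S.Nonempty := by
    obtain ⟨⟨k, l⟩, hkl⟩ := Function.ne_iff.mp hp
    refine ⟨k, Finset.mem_filter.mpr ⟨Finset.mem_univ _, fun h0 => hkl ?_⟩⟩
    have := hPPdeg k 0 l
    rw [h0] at this
    simpa using this.symm
  set s := S.card with hs
  have hs0 : 0 < s := Finset.card_pos.mpr hSne
  have hsK : s ≤ K := by simpa using Finset.card_le_univ S
  let κ : Fin s → Fin K := fun i => (S.equivFin.symm i : Fin K)
  have hκinj : Function.Injective κ := fun i j hij =>
    S.equivFin.symm.injective (Subtype.ext hij)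
  have hκ0 : ∀ i, PP (κ i) 0 ≠ 0 := fun i => (Finset.mem_filter.mp (S.equivFin.symm i).2).2
  have hnotS : ∀ k, k ∉ S → ∀ l, p (k, l) = 0 := by
    intro k hk l
    have h0 : PP k 0 = 0 := by
      by_contra h0; exact hk (Finset.mem_filter.mpr ⟨Finset.mem_univ _, h0⟩)
    have := hPPdeg k 0 l
    rw [h0] at this
    simpa using this.symm
  have hsumκ : ∀ F : Fin K → ℂ[X], (∀ k, k ∉ S → F k = 0) → ∑ i, F (κ i) = ∑ k, F k := by
    intro F hF
    calc ∑ i, F (κ i) = ∑ y : S, F y := Equiv.sum_comp S.equivFin.symm (fun y : S => F y)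
      _ = ∑ k ∈ S, F k := Finset.sum_coe_sort S F
      _ = ∑ k, F k := Finset.sum_subset (Finset.subset_univ _) fun k _ hk => hF k hk
  -- degrees
  let dd : Fin s → ℕ := fun i => (PP (κ i) 0).natDegree
  have hlc : ∀ i, (PP (κ i) 0).coeff (dd i) ≠ 0 := fun i => by
    simpa [dd] using hκ0 i
  have hddL : ∀ i, dd i < L := by
    intro i
    by_contra hge
    have := hPPdeg (κ i) 0 (dd i)
    rw [dif_neg hge] at this
    exact hlc i this
  have hco : ∀ i (j : ℕ) e, (PP (κ i) j).coeff e =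
      (PP (κ i) 0).coeff e * (((κ i : ℕ) * n + e * m : ℕ) : ℂ) ^ j := by
    intro i j e
    rw [hPPdeg, hPPdeg]
    split_ifs with he
    · simp [xx]
    · simp
  have hPPnat : ∀ i (j : ℕ), (PP (κ i) j).natDegree ≤ dd i := by
    intro i j
    rw [natDegree_le_iff_coeff_eq_zero]
    intro e he
    rw [hco, coeff_eq_zero_of_natDegree_lt he, zero_mul]
  let A : Matrix (Fin s) (Fin s) ℂ[X] := Matrix.of fun j i => PP (κ i) j
  let A' : Matrix (Fin s) (Fin s) ℂ[X] := Matrix.of fun j i => X ^ (L - dd i) * A j i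
  have hA'deg : ∀ j i, (A' j i).natDegree ≤ L := by
    intro j i
    simp only [A', A, Matrix.of_apply]
    refine natDegree_mul_le.trans ?_
    have := hPPnat i j
    have := hddL i
    rw [natDegree_X_pow]; omega
  obtain ⟨hdeg, hcoef⟩ := PL_coeff_det L A' hA'deg
  have hW0 : A'.det ≠ 0 := by
    intro h0
    rw [h0, coeff_zero] at hcoef
    have : (A'.map fun q => q.coeff L) = Matrix.of fun j i => (PP (κ i) 0).coeff (dd i) *
        (Matrix.vandermonde (fun i : Fin s => (((κ i : ℕ) * n + dd i * m : ℕ) : ℂ))).transpose j i := by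
      ext j i
      simp only [Matrix.map_apply, A', A, Matrix.of_apply, Matrix.transpose_apply,
        Matrix.vandermonde_apply]
      rw [← hco]
      have := hddL i
      conv_lhs => rw [show L = dd i + (L - dd i) by omega]
      rw [Nat.add_sub_cancel_left, mul_comm, coeff_mul_X_pow]
    rw [this, Matrix.det_mul_row, Matrix.det_transpose] at hcoef
    rcases mul_eq_zero.mp hcoef.symm with h1 | h1
    · obtain ⟨i, _, hi⟩ := Finset.prod_eq_zero_iff.mp h1
      exact hlc i hi
    · refine Matrix.det_vandermonde_ne_zero_iff.mpr ?_ h1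
      intro i j hij
      have hij' : (κ i : ℕ) * n + dd i * m = (κ j : ℕ) * n + dd j * m := by
        simp only at hij
        exact_mod_cast hij
      exact hκinj (Fin.ext (hx _ _ _ _ (hddL i) (hddL j) hij'))
  have hAA' : A'.det = (∏ i, X ^ (L - dd i)) * A.det := Matrix.det_mul_row _ _
  set T' := T + 1 - K with hT'
  have hdvd : ∀ r < R, (X - C (α ^ r)) ^ T' ∣ A'.det := by
    intro r hr
    set β := α ^ r with hβ
    have hβ0 : β ≠ 0 := pow_ne_zero _ hα0
    refine PL_mult_comp _ hW0 β hβ0 m hm T' ?_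
    rw [hAA', mul_comp]
    refine Dvd.dvd.mul_left ?_ _
    let G : ℕ → ℂ[X] := fun t => ∑ k : Fin K, ∑ l : Fin L,
      C (p (k, l) * (xx k l : ℂ) ^ t * β ^ (l : ℕ)) * X ^ (xx k l)
    have hGd : ∀ t, X * derivative (G t) = G (t + 1) := by
      intro t
      simp only [G, derivative_sum, Finset.mul_sum, derivative_C_mul, derivative_X_pow]
      refine Finset.sum_congr rfl fun k _ => Finset.sum_congr rfl fun l _ => ?_
      rcases Nat.eq_zero_or_pos (xx k l) with h0 | h0
      · simp [h0]
      · have : (X : ℂ[X]) ^ (xx k l) = X * X ^ (xx k l - 1) := by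
          rw [← pow_succ', Nat.sub_add_cancel h0]
        rw [this]
        simp only [C_mul, C_pow, pow_succ]
        ring
    have hG1 : ∀ t < T, (G t).eval 1 = 0 := by
      intro t ht
      rw [← h t ht r hr, Fintype.sum_prod_type]
      simp only [G, eval_finsetSum, eval_mul, eval_C, eval_pow, eval_X, one_pow, mul_one]
      refine Finset.sum_congr rfl fun k _ => Finset.sum_congr rfl fun l _ => ?_
      simp only [xx, hβ]; ring
    have hGdvd := PL_dvd_chain G T hGd hG1
    let φ := (compRingHom (C β * X ^ m) : ℂ[X] →+* ℂ[X])
    have hφ : A.det.comp (C β * X ^ m) = (φ.mapMatrix A).det := by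
      rw [← RingHom.map_det]; rfl
    rw [hφ]
    set B := φ.mapMatrix A with hB
    let i0 : Fin s := ⟨0, hs0⟩
    let c : Fin s → ℂ[X] := fun i => X ^ ((κ i : ℕ) * n)
    have hcol := Matrix.det_updateCol_sum B i0 c
    have hGcol : (fun j : Fin s => ∑ i, c i • B j i) = fun j : Fin s => G j := by
      funext j
      simp only [smul_eq_mul, hB, c, RingHom.mapMatrix_apply, Matrix.map_apply, A, Matrix.of_apply]
      rw [hsumκ (fun k => X ^ ((k : ℕ) * n) * φ (PP k j))]
      · refine Finset.sum_congr rfl fun k _ => ?_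
        simp only [PP, map_sum, Finset.mul_sum, φ, coe_compRingHom_apply, mul_comp, C_comp,
          X_pow_comp]
        refine Finset.sum_congr rfl fun l _ => ?_
        simp only [xx, mul_pow, C_mul, C_pow, pow_add, ← pow_mul]
        ring
      · intro k hk
        have : PP k j = 0 := by
          simp only [PP]
          exact Finset.sum_eq_zero fun l _ => by simp [hnotS k hk l]
        rw [this, map_zero, mul_zero]
    rw [hGcol] at hcol
    have hex : ∀ j : Fin s, ∃ w : ℂ[X], G j = (X - C 1) ^ T' * w := fun j =>
      hGdvd T' j (by have := j.2; omega)
    choose w hw using hex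
    have hGw : (fun j : Fin s => G j) = ((X - C 1) ^ T' : ℂ[X]) • w := by
      funext j; simpa using hw j
    rw [hGw, Matrix.det_updateCol_smul] at hcol
    have hdv : (X - C 1) ^ T' ∣ c i0 * B.det := by
      rw [smul_eq_mul] at hcol
      exact ⟨_, hcol.symm⟩
    have hcop : IsCoprime ((X - C 1 : ℂ[X]) ^ T') (c i0) := by
      have : IsCoprime (X - C 1 : ℂ[X]) X := ⟨-1, 1, by simp⟩
      exact this.pow
    exact hcop.dvd_of_dvd_mul_left hdv
  have hprod : ∏ r ∈ Finset.range R, (X - C (α ^ r)) ^ T' ∣ A'.det := by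
    refine Finset.prod_dvd_of_coprime ?_ fun r hr => hdvd r (Finset.mem_range.mp hr)
    intro r hr r' hr' hne
    refine IsCoprime.pow ?_
    refine isCoprime_X_sub_C_of_isUnit_sub ?_
    refine IsUnit.mk0 _ (sub_ne_zero.mpr fun h => hne ?_)
    exact hinj r (by simpa using hr) r' (by simpa using hr') h
  have hle := natDegree_le_of_dvd hprod hW0
  rw [natDegree_prod _ _ (fun r _ => pow_ne_zero _ (X_sub_C_ne_zero _))] at hle
  simp only [natDegree_pow, natDegree_X_sub_C, mul_one, Finset.sum_const, Finset.card_range,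
    smul_eq_mul] at hle
  have : s * L ≤ K * L := Nat.mul_le_mul_right _ hsK
  omega



theorem PL_det_ineq (α : ℂ) (hα1 : ‖α‖ = 1) (hαfo : ∀ j : ℕ, 0 < j → α ^ j ≠ 1)
    (C : ℝ) (hC1 : 1 ≤ C) (d : ℕ)
    (hLi : ∀ (D : ℤ[X]) (M : ℕ) (H : ℝ), 1 ≤ H → D.natDegree ≤ M →
      (∀ z : ℂ, ‖aeval z D‖ ≤ H * (max 1 ‖z‖) ^ M) → aeval α D ≠ 0 →
      1 ≤ ‖aeval α D‖ * (H * C ^ M) ^ d)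
    (n m K L T R : ℕ) (hn : 0 < n) (hm : 0 < m) (hmn : m ≤ 2 * n)
    (hT : K * L < R * (T + 1 - K)) (hKT : K ≤ T) (hKL : 2 ≤ K * L) (hR : 1 ≤ R)
    (H : ℝ) (hH : H = ((K * L).factorial : ℝ) * (((n * (K + 2 * L) : ℕ) : ℝ) ^ T) ^ (K * L))
    (M : ℕ) (hM : M = K * L * (L * R))
    (hδ : H * 2 ^ M * ‖α - Complex.exp (2 * Real.pi * Complex.I / n * m)‖ * (H * C ^ M) ^ d < 1 / 2) :
    ∃ Z : ℝ, 0 ≤ Z ∧ 1 / 2 ≤ Z * (H * C ^ M) ^ d ∧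
      Z * (Real.exp 1) ^ (K * L * (K * L - 1) / 2) ≤ ((K * L).factorial : ℝ) *
        ((((n * (K + 2 * L) : ℕ) : ℝ) * Real.exp 1) ^ T *
          Real.exp (2 * Real.pi * R * (K + 2 * L) * Real.exp 1)) ^ (K * L) := by
  classical
  set ζ := Complex.exp (2 * Real.pi * Complex.I / n * m) with hζ
  have hn' : (n : ℂ) ≠ 0 := by exact_mod_cast hn.ne'
  have hα0 : α ≠ 0 := by rintro rfl; simp at hα1
  have hζ1 : ‖ζ‖ = 1 := by
    have : (2 * Real.pi * Complex.I / n * m : ℂ) = ((2 * Real.pi / n * m : ℝ) : ℂ) * Complex.I := by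
      push_cast; ring
    rw [hζ, this, Complex.norm_exp_ofReal_mul_I]
  have hζn : ζ ^ n = 1 := by
    rw [hζ, ← Complex.exp_nat_mul]
    have : (n : ℂ) * (2 * Real.pi * Complex.I / n * m) = m * (2 * Real.pi * Complex.I) := by
      field_simp
    rw [this, Complex.exp_nat_mul_two_pi_mul_I]
  have hK0 : 0 < K := by rcases Nat.eq_zero_or_pos K with h | h; · simp [h] at hKL
                         · exact h
  have hL0 : 0 < L := by rcases Nat.eq_zero_or_pos L with h | h; · simp [h] at hKL
                         · exact h
  set Xn := n * (K + 2 * L) with hXn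
  have hXn1 : 1 ≤ Xn := Nat.mul_pos hn (by omega)
  have hXr : (1 : ℝ) ≤ (Xn : ℝ) := by exact_mod_cast hXn1
  have hH2 : 2 ≤ H := by
    rw [hH]
    have h1 : (2 : ℝ) ≤ ((K * L).factorial : ℝ) := by
      exact_mod_cast hKL.trans (Nat.self_le_factorial _)
    have h2 : (1 : ℝ) ≤ ((Xn : ℝ) ^ T) ^ (K * L) := one_le_pow₀ (one_le_pow₀ hXr)
    nlinarith
  have hLM : L ≤ M := by
    rw [hM]
    calc L = 1 * (L * 1) := by ring
      _ ≤ K * L * (L * R) := Nat.mul_le_mul (by omega) (Nat.mul_le_mul_left _ hR)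
  -- distinctness
  have hord : ∀ j : ℕ, 0 < j → j < L → ζ ^ j ≠ 1 := by
    intro j hj hjL hζj
    have hb : ∀ z : ℂ, ‖aeval z (X ^ j - 1 : ℤ[X])‖ ≤ 2 * (max 1 ‖z‖) ^ j := by
      intro z
      simp only [map_sub, map_pow, aeval_X, map_one]
      refine (norm_sub_le _ _).trans ?_
      rw [norm_pow, norm_one]
      have h1 : ‖z‖ ^ j ≤ (max 1 ‖z‖) ^ j := pow_le_pow_left₀ (norm_nonneg _) (le_max_right _ _) _
      have h2 : 1 ≤ (max 1 ‖z‖) ^ j := one_le_pow₀ (le_max_left _ _)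
      linarith
    have h1 := hLi (X ^ j - 1) j 2 (by norm_num) (by
      refine (natDegree_sub_le _ _).trans ?_
      simp) hb (by simpa [sub_eq_zero] using hαfo j hj)
    have h2 := PL_perturb (X ^ j - 1) j 2 (by norm_num) hb α ζ hα1.le hζ1.le
    have h3 : (aeval ζ (X ^ j - 1 : ℤ[X])) = 0 := by simp [hζj]
    rw [h3, sub_zero] at h2
    have hjM : j ≤ M := by omega
    have h4 : ‖aeval α (X ^ j - 1 : ℤ[X])‖ * (2 * C ^ j) ^ d ≤
        (H * 2 ^ M * ‖α - ζ‖) * (H * C ^ M) ^ d := by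
      gcongr
      · refine h2.trans ?_
        gcongr
        norm_num
    linarith
  have hx : ∀ k l k' l' : ℕ, l < L → l' < L → k * n + l * m = k' * n + l' * m → k = k' := by
    have key : ∀ k l k' l' : ℕ, l < L → l' < L → l ≤ l' → k * n + l * m = k' * n + l' * m →
        k = k' := by
      intro k l k' l' hl hl' hll heq
      obtain ⟨j, rfl⟩ := Nat.exists_eq_add_of_le hll
      rcases Nat.eq_zero_or_pos j with h | h
      · subst h
        have : k * n = k' * n := by simpa using heq
        exact Nat.eq_of_mul_eq_mul_right hn this
      · exfalso
        refine hord j h (by omega) ?_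
        have h1 : k * n = k' * n + j * m := by nlinarith
        have h2 : ζ ^ j = Complex.exp (((j * m : ℕ) : ℂ) * (2 * Real.pi * Complex.I / n)) := by
          rw [hζ, ← Complex.exp_nat_mul]; congr 1; push_cast; ring
        have h3 : ((j * m : ℕ) : ℂ) = ((k : ℂ) - k') * n := by
          have : (k : ℂ) * n = k' * n + (j * m : ℕ) := by exact_mod_cast h1
          linear_combination - this
        rw [h2, h3]
        have h4 : ((k : ℂ) - k') * n * (2 * Real.pi * Complex.I / n) =
            (((k : ℤ) - k' : ℤ) : ℂ) * (2 * Real.pi * Complex.I) := by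
          push_cast; field_simp
        rw [h4, Complex.exp_int_mul_two_pi_mul_I]
    intro k l k' l' hl hl' heq
    rcases le_total l l' with h | h
    · exact key k l k' l' hl hl' h heq
    · exact (key k' l' k l hl' hl h heq.symm).symm
  have hinj : ∀ r < R, ∀ r' < R, α ^ r = α ^ r' → r = r' := by
    have key : ∀ r r' : ℕ, r ≤ r' → α ^ r = α ^ r' → r = r' := by
      intro r r' hle h
      obtain ⟨j, rfl⟩ := Nat.exists_eq_add_of_le hle
      rcases Nat.eq_zero_or_pos j with h0 | h0
      · omega
      · exfalso
        refine hαfo j h0 ?_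
        rw [pow_add] at h
        exact (mul_left_cancel₀ (pow_ne_zero r hα0) (by rw [mul_one]; exact h)).symm
    intro r _ r' _ h
    rcases le_total r r' with h1 | h1
    · exact key r r' h1 h
    · exact (key r' r h1 h.symm).symm
  -- matrix
  let ι := Fin K × Fin L
  let xx : ι → ℕ := fun q => (q.1 : ℕ) * n + (q.2 : ℕ) * m
  have hxX : ∀ q, xx q ≤ Xn := by
    intro q
    have h1 : (q.1 : ℕ) * n ≤ K * n := Nat.mul_le_mul_right _ q.1.2.le
    have h2 : (q.2 : ℕ) * m ≤ L * (2 * n) := Nat.mul_le_mul q.2.2.le hmn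
    simp only [xx, hXn]
    nlinarith
  let BM : Matrix (Fin T × Fin R) ι ℂ :=
    Matrix.of fun a q => (xx q : ℂ) ^ (a.1 : ℕ) * (α ^ (a.2 : ℕ)) ^ (q.2 : ℕ)
  obtain ⟨e, he⟩ := PL_minor BM (by
    intro p hp
    refine PL_zero_est K L T R n m hm.ne' α hα0 hinj hx hT hKT p ?_
    intro t ht r hr
    have := congrFun hp (⟨t, ht⟩, ⟨r, hr⟩)
    simpa [Matrix.mulVec, dotProduct, BM, xx] using this)
  let DM : Matrix ι ι ℤ[X] := Matrix.of fun i q =>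
    ((xx q : ℕ) : ℤ[X]) ^ ((e i).1 : ℕ) * X ^ (((e i).2 : ℕ) * (q.2 : ℕ))
  set D := DM.det with hD
  have hcard : Fintype.card ι = K * L := by simp [ι]
  have heval : ∀ z : ℂ, aeval z D = (Matrix.of fun i q : ι =>
      (xx q : ℂ) ^ ((e i).1 : ℕ) * z ^ (((e i).2 : ℕ) * (q.2 : ℕ))).det := by
    intro z
    rw [hD, AlgHom.map_det]
    congr 1
    ext i q
    simp [DM]
  have hDα : aeval α D ≠ 0 := by
    rw [heval]
    convert he using 2
    ext i q
    simp [BM, pow_mul]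
  have hexple : ∀ i q : ι, ((e i).2 : ℕ) * (q.2 : ℕ) ≤ L * R := by
    intro i q
    rw [mul_comm L]
    exact Nat.mul_le_mul (e i).2.2.le q.2.2.le
  have hdeg : D.natDegree ≤ M := by
    rw [hD, Matrix.det_apply]
    refine natDegree_sum_le_of_forall_le _ _ fun σ _ => ?_
    refine (natDegree_smul_le _ _).trans ?_
    refine (natDegree_prod_le _ _).trans ?_
    refine (Finset.sum_le_card_nsmul _ _ (L * R) fun i _ => ?_).trans ?_
    · simp only [DM, Matrix.of_apply]
      refine natDegree_mul_le.trans ?_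
      rw [natDegree_X_pow, ← Nat.cast_pow, natDegree_natCast, zero_add]
      exact hexple _ _
    · rw [Finset.card_univ, hcard, smul_eq_mul, hM]
  have hbd : ∀ z : ℂ, ‖aeval z D‖ ≤ H * (max 1 ‖z‖) ^ M := by
    intro z
    rw [heval]
    refine (PL_det_row_le _ (fun _ => (Xn : ℝ) ^ T * (max 1 ‖z‖) ^ (L * R)) ?_).trans ?_
    · intro i q
      simp only [Matrix.of_apply, norm_mul, norm_pow, Complex.norm_natCast]
      gcongr
      · calc (xx q : ℝ) ^ ((e i).1 : ℕ) ≤ (Xn : ℝ) ^ ((e i).1 : ℕ) := by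
              gcongr; exact hxX q
          _ ≤ (Xn : ℝ) ^ T := pow_le_pow_right₀ hXr (e i).1.2.le
      · calc ‖z‖ ^ (((e i).2 : ℕ) * (q.2 : ℕ)) ≤ (max 1 ‖z‖) ^ (((e i).2 : ℕ) * (q.2 : ℕ)) := by
              gcongr; exact le_max_right _ _
          _ ≤ _ := pow_le_pow_right₀ (le_max_left _ _) (hexple i q)
    · rw [Finset.prod_const, Finset.card_univ, hcard, hH, hM, mul_pow, ← pow_mul _ (L * R),
        mul_comm (L * R)]
      exact le_of_eq (mul_assoc _ _ _).symm
  have hmain := hLi D M H (by linarith) hdeg hbd hDα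
  have hpert := PL_perturb D M H (by linarith) hbd α ζ hα1.le hζ1.le
  refine ⟨‖aeval ζ D‖, norm_nonneg _, ?_, ?_⟩
  · have h1 : ‖aeval α D‖ ≤ ‖aeval ζ D‖ + H * 2 ^ M * ‖α - ζ‖ := by
      calc ‖aeval α D‖ = ‖aeval ζ D + (aeval α D - aeval ζ D)‖ := by ring_nf
        _ ≤ _ := (norm_add_le _ _).trans (by linarith)
    have h2 : 0 ≤ (H * C ^ M) ^ d := by positivity
    have h3 := mul_le_mul_of_nonneg_right h1 h2
    rw [add_mul] at h3
    linarith
  · have hup := PL_det_upper (ι := ι) (fun q => (xx q : ℝ)) (Xn : ℝ) hXr (fun _ => by positivity)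
      (fun q => by exact_mod_cast hxX q) (fun i => ((e i).1 : ℕ)) (fun i => ((e i).2 : ℕ)) T
      (fun i => (e i).1.2.le) (2 * Real.pi * Complex.I / n) (2 * Real.pi * R * (K + 2 * L)) (by
        intro i
        have h1 : ‖(2 * Real.pi * Complex.I / n : ℂ)‖ = 2 * Real.pi / n := by
          simp [abs_of_pos Real.pi_pos]
        have h2 : (((e i).2 : ℕ) : ℝ) ≤ R := by exact_mod_cast (e i).2.2.le
        have hnr : (n : ℝ) ≠ 0 := by exact_mod_cast hn.ne'
        rw [h1]
        calc 2 * Real.pi / n * (((e i).2 : ℕ) : ℝ) * (Xn : ℝ)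
            ≤ 2 * Real.pi / n * R * (Xn : ℝ) := by gcongr
          _ = _ := by rw [hXn]; push_cast; field_simp) (Real.exp 1)
      (Real.one_le_exp (by norm_num))
    rw [hcard] at hup
    refine le_trans (le_of_eq ?_) hup
    congr 2
    rw [heval]
    congr 1
    ext i q
    simp only [Matrix.of_apply, Complex.ofReal_natCast]
    congr 1
    rw [hζ, ← Complex.exp_nat_mul]
    have h1 : (2 * Real.pi * Complex.I / n * (((e i).2 : ℕ) : ℂ) * (xx q : ℂ)) =
        ((((e i).2 : ℕ) * (q.2 : ℕ) : ℕ) : ℂ) * (2 * Real.pi * Complex.I / n * m) +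
        ((((e i).2 : ℕ) * (q.1 : ℕ) : ℕ) : ℂ) * (2 * Real.pi * Complex.I) := by
      simp only [xx]
      push_cast
      field_simp
      ring
    rw [h1, Complex.exp_add, Complex.exp_nat_mul_two_pi_mul_I, mul_one]


theorem PL_near (α : ℂ) (hα1 : ‖α‖ = 1) (n : ℕ) (hn : 0 < n) :
    ∃ m : ℕ, 0 < m ∧ m ≤ 2 * n ∧
      ‖α - Complex.exp (2 * Real.pi * Complex.I / n * m)‖ ≤ 2 * ‖α ^ n - 1‖ := by
  set φ : ℝ := Complex.arg α + 2 * Real.pi with hφ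
  have hαφ : α = Complex.exp (Complex.I * φ) := by
    have h := Complex.norm_mul_exp_arg_mul_I α
    rw [hα1] at h
    rw [hφ]
    push_cast
    rw [mul_add, Complex.exp_add]
    have : Complex.I * (2 * Real.pi) = 2 * Real.pi * Complex.I := by ring
    rw [this, Complex.exp_two_pi_mul_I, mul_one, mul_comm]
    simpa using h.symm
  have hpi := Real.pi_pos
  have h1 : -Real.pi < Complex.arg α := Complex.neg_pi_lt_arg α
  have h2 : Complex.arg α ≤ Real.pi := Complex.arg_le_pi α
  have hnr : (1 : ℝ) ≤ n := by exact_mod_cast hn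
  set θ : ℝ := φ / (2 * Real.pi) with hθ
  have hθ1 : 1 / 2 < θ := by rw [hθ, lt_div_iff₀ (by positivity)]; linarith
  have hθ2 : θ ≤ 3 / 2 := by rw [hθ, div_le_iff₀ (by positivity)]; linarith
  have hφθ : φ = 2 * Real.pi * θ := by rw [hθ]; field_simp
  set M : ℤ := round (n * θ) with hM
  have hr := abs_sub_round (n * θ)
  rw [← hM, abs_le] at hr
  have hMpos : 0 < M := by
    have : (0 : ℝ) < M := by nlinarith
    exact_mod_cast this
  obtain ⟨m, hm⟩ := Int.eq_ofNat_of_zero_le hMpos.le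
  have hMm : (M : ℝ) = m := by rw [hm]; simp
  rw [hMm] at hr
  refine ⟨m, by omega, ?_, ?_⟩
  · have : (m : ℝ) ≤ 2 * n := by nlinarith
    exact_mod_cast this
  set u : ℝ := n * φ - 2 * Real.pi * m with hu
  have huu : u = 2 * Real.pi * (n * θ - m) := by rw [hu, hφθ]; ring
  have hul : |u| ≤ Real.pi := by
    rw [huu, abs_le]; constructor <;> nlinarith
  have hpow : α ^ n = Complex.exp (Complex.I * u) := by
    rw [hαφ, ← Complex.exp_nat_mul, hu]
    have : (n : ℂ) * (Complex.I * φ) = Complex.I * ((n * φ - 2 * Real.pi * m : ℝ) : ℂ) +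
        m * (2 * Real.pi * Complex.I) := by push_cast; ring
    rw [this, Complex.exp_add, Complex.exp_nat_mul_two_pi_mul_I, mul_one]
  have hlow : |u| ≤ 2 * ‖α ^ n - 1‖ := by
    rw [hpow, Complex.norm_exp_I_mul_ofReal_sub_one, Real.norm_eq_abs, abs_mul]
    have hs : |Real.sin (u / 2)| = Real.sin (|u| / 2) := by
      have h3 : 0 ≤ Real.sin (|u| / 2) :=
        Real.sin_nonneg_of_nonneg_of_le_pi (by positivity) (by linarith)
      rcases abs_cases u with ⟨h, _⟩ | ⟨h, _⟩
      · rw [h] at h3 ⊢; exact abs_of_nonneg h3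
      · rw [h, neg_div, Real.sin_neg] at h3 ⊢
        exact abs_of_nonpos (by linarith)
    rw [hs]
    have h4 := Real.mul_le_sin (x := |u| / 2) (by positivity) (by linarith)
    have h5 : 1 / 4 * |u| ≤ 2 / Real.pi * (|u| / 2) := by
      have : 1 / 4 ≤ 1 / Real.pi := one_div_le_one_div_of_le hpi Real.pi_le_four
      calc 1 / 4 * |u| ≤ 1 / Real.pi * |u| := by gcongr
        _ = _ := by ring
    rw [abs_two]
    linarith
  refine le_trans ?_ hlow
  have hfac : α - Complex.exp (2 * Real.pi * Complex.I / n * m) =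
      Complex.exp (2 * Real.pi * Complex.I / n * m) *
        (Complex.exp (Complex.I * ((u / n : ℝ) : ℂ)) - 1) := by
    rw [mul_sub, mul_one, ← Complex.exp_add, hαφ]
    congr 2
    rw [hu]
    have : (n : ℂ) ≠ 0 := by exact_mod_cast hn.ne'
    push_cast
    field_simp
    ring
  have hζ1 : ‖Complex.exp (2 * Real.pi * Complex.I / n * m)‖ = 1 := by
    have : (2 * Real.pi * Complex.I / n * m : ℂ) = ((2 * Real.pi / n * m : ℝ) : ℂ) * Complex.I := by
      push_cast; ring
    rw [this, Complex.norm_exp_ofReal_mul_I]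
  rw [hfac, norm_mul, hζ1, one_mul]
  refine Real.norm_exp_I_mul_ofReal_sub_one_le.trans ?_
  rw [Real.norm_eq_abs, abs_div, Nat.abs_cast]
  exact div_le_self (abs_nonneg _) hnr

set_option maxHeartbeats 1000000 in
/-- Main asymptotic estimate with explicit parameters. -/
theorem PL_asym (C : ℝ) (hC1 : 1 ≤ C) (d : ℕ) (ε : ℝ) (n s : ℕ)
    (hs1 : s ^ 10 ≤ n) (hs2 : n < (s + 1) ^ 10) (hsbig : 100000 ≤ s)
    (hs3 : ((d : ℝ) + 1) * 1001 * (40 + 15 * Real.log s + Real.log (2 * C)) ≤ s)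
    (hs4 : 2000 ≤ ε * (s : ℝ) ^ 4)
    (K L T R : ℕ) (hK : K = s ^ 2) (hL : L = 1000 * s) (hT : T = 1001 * s ^ 2) (hR : R = s)
    (H : ℝ) (hH : H = ((K * L).factorial : ℝ) * (((n * (K + 2 * L) : ℕ) : ℝ) ^ T) ^ (K * L))
    (M : ℕ) (hM : M = K * L * (L * R)) :
    H * 2 ^ M * (2 * Real.exp (-ε * n)) * (H * C ^ M) ^ d < 1 / 2 ∧
    ∀ Z : ℝ, 0 ≤ Z →
      Z * (Real.exp 1) ^ (K * L * (K * L - 1) / 2) ≤ ((K * L).factorial : ℝ) *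
        ((((n * (K + 2 * L) : ℕ) : ℝ) * Real.exp 1) ^ T *
          Real.exp (2 * Real.pi * R * (K + 2 * L) * Real.exp 1)) ^ (K * L) →
      Z * (H * C ^ M) ^ d < 1 / 2 := by
  have hsr : (100000 : ℝ) ≤ s := by exact_mod_cast hsbig
  have hs0 : (0 : ℝ) < s := by linarith
  set Xn := n * (K + 2 * L) with hXn
  set N := K * L with hN
  clear_value Xn N
  have hNs : (N : ℝ) = 1000 * (s : ℝ) ^ 3 := by rw [hN, hK, hL]; push_cast; ring
  have hN1 : 1 ≤ N := by
    have : (1 : ℝ) ≤ N := by rw [hNs]; nlinarith [pow_pos hs0 3, pow_le_pow_left₀ (by norm_num) hsr 3]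
    exact_mod_cast this
  have hNpos : (0 : ℝ) < N := by exact_mod_cast hN1
  have hls : 0 ≤ Real.log s := Real.log_nonneg (by linarith)
  have hl2C : 0 ≤ Real.log (2 * C) := Real.log_nonneg (by linarith)
  -- log of N
  have hlogN : Real.log N ≤ 7 + 3 * Real.log s := by
    rw [hNs, Real.log_mul (by norm_num) (by positivity), Real.log_pow]
    have : Real.log 1000 ≤ 7 := by
      rw [Real.log_le_iff_le_exp (by norm_num)]
      have h := Real.exp_one_gt_d9
      calc (1000 : ℝ) ≤ 2.7182818283 ^ 7 := by norm_num
        _ ≤ (Real.exp 1) ^ 7 := by gcongr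
        _ = Real.exp 7 := by rw [← Real.exp_nat_mul]; norm_num
    push_cast
    linarith
  have hn0 : 0 < n := lt_of_lt_of_le (by positivity) hs1
  have hXpos : 0 < Xn := by
    rw [hXn, hK]; have : 0 < s ^ 2 := by positivity
    exact Nat.mul_pos hn0 (by omega)
  have hXr : (0 : ℝ) < Xn := by exact_mod_cast hXpos
  have hlogX : Real.log Xn ≤ 21 + 12 * Real.log s := by
    have h1 : (Xn : ℝ) ≤ 2 ^ 21 * (s : ℝ) ^ 12 := by
      have h2 : (n : ℝ) ≤ ((s : ℝ) + 1) ^ 10 := by exact_mod_cast hs2.le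
      have h3 : ((s : ℝ) + 1) ^ 10 ≤ (2 * s) ^ 10 := by gcongr; linarith
      have h4 : (Xn : ℝ) = n * ((s : ℝ) ^ 2 + 2000 * s) := by
        rw [hXn, hK, hL]; push_cast; ring
      have h5 : (s : ℝ) ^ 2 + 2000 * s ≤ 2 ^ 11 * (s : ℝ) ^ 2 := by nlinarith
      rw [h4]
      calc (n : ℝ) * ((s : ℝ) ^ 2 + 2000 * s) ≤ (2 * s) ^ 10 * (2 ^ 11 * (s : ℝ) ^ 2) := by
            gcongr; exact h2.trans h3
        _ = _ := by ring
    refine (Real.log_le_log hXr h1).trans ?_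
    rw [Real.log_mul (by positivity) (by positivity), Real.log_pow, Real.log_pow]
    have := Real.log_two_lt_d9
    push_cast
    linarith
  -- the quantity Q
  set Q : ℝ := Real.log N + T * (Real.log Xn + 1) + (L * R : ℕ) * Real.log (2 * C) with hQ
  clear_value Q
  have hTr : (T : ℝ) = 1001 * (s : ℝ) ^ 2 := by rw [hT]; push_cast; ring
  have hLRr : ((L * R : ℕ) : ℝ) = 1000 * (s : ℝ) ^ 2 := by rw [hL, hR]; push_cast; ring
  have hlogX0 : 0 ≤ Real.log Xn := Real.log_natCast_nonneg _
  have hlogN0 : 0 ≤ Real.log N := Real.log_natCast_nonneg _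
  have hs21 : (1 : ℝ) ≤ (s : ℝ) ^ 2 := one_le_pow₀ (by linarith)
  have hQle : Q ≤ 1001 * (s : ℝ) ^ 2 * (40 + 15 * Real.log s + Real.log (2 * C)) := by
    rw [hQ, hTr, hLRr]
    have e1 : Real.log N ≤ 1001 * (s : ℝ) ^ 2 * (7 + 3 * Real.log s) := by
      refine hlogN.trans (le_mul_of_one_le_left (by positivity) (by linarith))
    have e2 : 1001 * (s : ℝ) ^ 2 * (Real.log Xn + 1) ≤ 1001 * (s : ℝ) ^ 2 * (22 + 12 * Real.log s) :=
      mul_le_mul_of_nonneg_left (by linarith) (by positivity)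
    have e3 : 1000 * (s : ℝ) ^ 2 * Real.log (2 * C) ≤ 1001 * (s : ℝ) ^ 2 * Real.log (2 * C) := by
      gcongr; norm_num
    have e4 : 0 ≤ 1001 * (s : ℝ) ^ 2 * 11 := by positivity
    nlinarith
  have hQ0 : 0 ≤ Q := by rw [hQ]; positivity
  have hQd : Q * (d + 1) ≤ (s : ℝ) ^ 3 := by
    calc Q * (d + 1) ≤ 1001 * (s : ℝ) ^ 2 * (40 + 15 * Real.log s + Real.log (2 * C)) * (d + 1) := by
          gcongr
      _ = (s : ℝ) ^ 2 * (((d : ℝ) + 1) * 1001 * (40 + 15 * Real.log s + Real.log (2 * C))) := by ring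
      _ ≤ (s : ℝ) ^ 2 * s := by gcongr
      _ = _ := by ring
  have hfact : (N.factorial : ℝ) ≤ Real.exp (N * Real.log N) := by
    rw [mul_comm, ← Real.rpow_def_of_pos hNpos, Real.rpow_natCast]
    exact_mod_cast Nat.factorial_le_pow N
  have hXT : (((Xn : ℕ) : ℝ) ^ T) ^ N = Real.exp (N * (T * Real.log Xn)) := by
    rw [Real.exp_nat_mul, Real.exp_nat_mul, Real.exp_log hXr]
  have hHle : H ≤ Real.exp (N * Real.log N + N * (T * Real.log Xn)) := by
    rw [hH, hXT, Real.exp_add]; gcongr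
  have hH0 : 0 ≤ H := by rw [hH]; positivity
  have h2C0 : 0 < 2 * C := by linarith
  have hpowM : (2 * C) ^ M = Real.exp (N * ((L * R : ℕ) * Real.log (2 * C))) := by
    rw [Real.exp_nat_mul, Real.exp_nat_mul, Real.exp_log h2C0, ← pow_mul, hM, mul_comm N]
  have hboth : H * (2 * C) ^ M ≤ Real.exp (N * Q) := by
    rw [hpowM]
    calc H * Real.exp (N * ((L * R : ℕ) * Real.log (2 * C)))
        ≤ Real.exp (N * Real.log N + N * (T * Real.log Xn)) *
          Real.exp (N * ((L * R : ℕ) * Real.log (2 * C))) := by gcongr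
      _ = Real.exp (N * Real.log N + N * (T * Real.log Xn) +
          N * ((L * R : ℕ) * Real.log (2 * C))) := by rw [← Real.exp_add]
      _ ≤ _ := by
        apply Real.exp_le_exp.mpr
        rw [hQ]
        have : 0 ≤ (N : ℝ) * T := by positivity
        nlinarith
  have hHC : H * C ^ M ≤ Real.exp (N * Q) := by
    refine le_trans ?_ hboth
    gcongr
    linarith
  have hH2 : H * 2 ^ M ≤ Real.exp (N * Q) := by
    refine le_trans ?_ hboth
    gcongr
    linarith
  have hHCd : (H * C ^ M) ^ d ≤ Real.exp (N * Q * d) := by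
    calc (H * C ^ M) ^ d ≤ (Real.exp (N * Q)) ^ d := by gcongr
      _ = _ := by rw [← Real.exp_nat_mul]; ring_nf
  have hNQ : (N : ℝ) * Q * (d + 1) ≤ N * (s : ℝ) ^ 3 := by
    rw [mul_assoc]; gcongr
  have hexp4 : Real.exp (-2) < 1 / 4 := by
    rw [Real.exp_neg, inv_lt_comm₀ (Real.exp_pos _) (by norm_num)]
    have h := Real.exp_one_gt_d9
    have : Real.exp 2 = (Real.exp 1) ^ 2 := by rw [← Real.exp_nat_mul]; norm_num
    rw [this]; nlinarith
  have hs61 : (1 : ℝ) ≤ (s : ℝ) ^ 6 := one_le_pow₀ (by linarith)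
  constructor
  · have h1 : (s : ℝ) ^ 10 ≤ n := by exact_mod_cast hs1
    have hε : 0 < ε := by
      by_contra hneg
      have : ε * (s : ℝ) ^ 4 ≤ 0 := mul_nonpos_of_nonpos_of_nonneg (not_lt.mp hneg) (by positivity)
      linarith
    have h2 : 2000 * (s : ℝ) ^ 6 ≤ ε * n := by
      calc 2000 * (s : ℝ) ^ 6 ≤ ε * (s : ℝ) ^ 4 * (s : ℝ) ^ 6 := by gcongr
        _ = ε * (s : ℝ) ^ 10 := by ring
        _ ≤ _ := by gcongr
    calc H * 2 ^ M * (2 * Real.exp (-ε * n)) * (H * C ^ M) ^ d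
        ≤ Real.exp (N * Q) * (2 * Real.exp (-ε * n)) * Real.exp (N * Q * d) := by gcongr
      _ = 2 * Real.exp (N * Q * (d + 1) + -ε * n) := by
          rw [show (N : ℝ) * Q * (d + 1) + -ε * n = N * Q + -ε * n + N * Q * d by ring,
            Real.exp_add, Real.exp_add]; ring
      _ ≤ 2 * Real.exp (-2) := by
          gcongr
          have h3 : (N : ℝ) * (s : ℝ) ^ 3 = 1000 * (s : ℝ) ^ 6 := by rw [hNs]; ring
          linarith only [h3, h2, hs61, hNQ]
      _ < 1 / 2 := by linarith only [hexp4]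
  · intro Z hZ0 hZ
    have hE : (Real.exp 1) ^ (N * (N - 1) / 2) = Real.exp (N * (N - 1) / 2) := by
      rw [← Real.exp_nat_mul, mul_one]
      congr 1
      have h2 : 2 ∣ N * (N - 1) := (Nat.even_mul_pred_self N).two_dvd
      rw [Nat.cast_div h2 (by norm_num)]
      push_cast [Nat.cast_sub hN1]
      ring
    have hY : 2 * Real.pi * R * (K + 2 * L) * Real.exp 1 ≤ 20 * (s : ℝ) ^ 3 := by
      have hp := Real.pi_lt_d2
      have he := Real.exp_one_lt_d9
      have h1 : (R : ℝ) * (K + 2 * L) = (s : ℝ) ^ 3 + 2000 * (s : ℝ) ^ 2 := by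
        rw [hR, hK, hL]; push_cast; ring
      have h2 : (s : ℝ) ^ 3 + 2000 * (s : ℝ) ^ 2 ≤ 1.02 * (s : ℝ) ^ 3 := by nlinarith
      calc 2 * Real.pi * R * (K + 2 * L) * Real.exp 1
          = 2 * Real.pi * (R * (K + 2 * L)) * Real.exp 1 := by ring
        _ ≤ 2 * 3.15 * (1.02 * (s : ℝ) ^ 3) * 2.7182818286 := by
            rw [h1]; gcongr
        _ ≤ _ := by nlinarith [pow_pos hs0 3]
    have hrhs : (N.factorial : ℝ) * (((Xn : ℝ) * Real.exp 1) ^ T *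
          Real.exp (2 * Real.pi * R * (K + 2 * L) * Real.exp 1)) ^ N ≤
        Real.exp (N * Q + N * (20 * (s : ℝ) ^ 3)) := by
      have h1 : ((Xn : ℝ) * Real.exp 1) ^ T = Real.exp (T * (Real.log Xn + 1)) := by
        conv_lhs => rw [← Real.exp_log hXr]
        rw [← Real.exp_add, ← Real.exp_nat_mul]
      rw [h1, ← Real.exp_add, ← Real.exp_nat_mul]
      have h2 : Real.exp ((N : ℝ) * (T * (Real.log Xn + 1) +
          2 * Real.pi * R * (K + 2 * L) * Real.exp 1)) ≤
          Real.exp (N * (T * (Real.log Xn + 1) + 20 * (s : ℝ) ^ 3)) :=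
        Real.exp_le_exp.mpr (mul_le_mul_of_nonneg_left (by linarith) hNpos.le)
      have h3 : 0 ≤ (N : ℝ) * ((L * R : ℕ) * Real.log (2 * C)) := by positivity
      refine (mul_le_mul hfact h2 (Real.exp_pos _).le (Real.exp_pos _).le).trans ?_
      rw [← Real.exp_add]
      apply Real.exp_le_exp.mpr
      rw [hQ]
      have h4 : (N : ℝ) * (Real.log N + T * (Real.log Xn + 1) + (L * R : ℕ) * Real.log (2 * C))
        = N * Real.log N + N * (T * (Real.log Xn + 1)) +
          (N : ℝ) * ((L * R : ℕ) * Real.log (2 * C)) := by ring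
      rw [h4, mul_add (N : ℝ) (T * (Real.log Xn + 1))]
      linarith
    rw [hE] at hZ
    have hZ' : Z ≤ Real.exp (N * Q + N * (20 * (s : ℝ) ^ 3) - N * (N - 1) / 2) := by
      rw [Real.exp_sub, le_div_iff₀ (Real.exp_pos _)]
      exact hZ.trans hrhs
    have h31 : (1 : ℝ) ≤ (s : ℝ) ^ 3 := one_le_pow₀ (by linarith only [hsr])
    have hN1r : (1 : ℝ) ≤ N := by exact_mod_cast hN1
    have hfin : N * Q * (d + 1) + N * (20 * (s : ℝ) ^ 3) - N * (N - 1) / 2 ≤ -2 := by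
      have k1 : (N : ℝ) * (N - 1) / 2 = 500 * (N * (s : ℝ) ^ 3) - N / 2 := by
        have : (N : ℝ) * (N - 1) / 2 = N * N / 2 - N / 2 := by ring
        rw [this]
        nth_rewrite 2 [hNs]
        ring
      have k2 : (N : ℝ) * 1 ≤ N * (s : ℝ) ^ 3 := mul_le_mul_of_nonneg_left h31 hNpos.le
      rw [k1]
      linarith only [k2, hN1r, hNQ]
    have hZd : Z * (H * C ^ M) ^ d ≤
        Real.exp (N * Q + N * (20 * (s : ℝ) ^ 3) - N * (N - 1) / 2) * Real.exp (N * Q * d) :=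
      mul_le_mul hZ' hHCd (by positivity) (Real.exp_pos _).le
    refine hZd.trans_lt ?_
    rw [← Real.exp_add]
    have h5 : N * Q + N * (20 * (s : ℝ) ^ 3) - N * (N - 1) / 2 + N * Q * d ≤ -2 := by
      linarith only [hfin]
    have := Real.exp_le_exp.mpr h5
    linarith only [this, hexp4]


/-- Core estimate: a unit-circle algebraic number that is not a root of unity does not
have powers exponentially close to `1`. -/
theorem PL_core (α : ℂ) (hα : IsAlgebraic ℚ α) (hα1 : ‖α‖ = 1)
    (hαfo : ∀ j : ℕ, 0 < j → α ^ j ≠ 1) (ε : ℝ) (hε : 0 < ε) :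
    ∀ᶠ n : ℕ in atTop, Real.exp (-ε * n) ≤ ‖α ^ n - 1‖ := by
  obtain ⟨C, hC1, d, hLi⟩ := PL_liouville α hα
  have hcast : Tendsto (fun s : ℕ => (s : ℝ)) atTop atTop := tendsto_natCast_atTop_atTop
  have e3 : ∀ᶠ s : ℕ in atTop,
      ((d : ℝ) + 1) * 1001 * (40 + 15 * Real.log s + Real.log (2 * C)) ≤ s := by
    have h1 : (fun x : ℝ => ((d : ℝ) + 1) * 1001 * (40 + 15 * Real.log x + Real.log (2 * C)))
        =o[atTop] (id : ℝ → ℝ) := by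
      refine Asymptotics.IsLittleO.const_mul_left ?_ _
      have hc : ∀ c : ℝ, (fun _ : ℝ => c) =o[atTop] (id : ℝ → ℝ) := fun c =>
        Asymptotics.isLittleO_const_id_atTop c
      exact ((hc 40).add (Real.isLittleO_log_id_atTop.const_mul_left 15)).add (hc _)
    have h2 := hcast.eventually (h1.bound (zero_lt_one))
    filter_upwards [h2] with s hs
    have := (le_abs_self _).trans hs
    simpa using this
  have e4 : ∀ᶠ s : ℕ in atTop, 2000 ≤ ε * (s : ℝ) ^ 4 := by
    have h1 : Tendsto (fun s : ℕ => ε * (s : ℝ) ^ 4) atTop atTop :=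
      ((tendsto_pow_atTop (by norm_num)).comp hcast).const_mul_atTop hε
    exact h1.eventually_ge_atTop 2000
  have e5 : ∀ᶠ s : ℕ in atTop, 100000 ≤ s := eventually_ge_atTop _
  have hfl : Tendsto (fun n : ℕ => ⌊(n : ℝ) ^ (1 / 10 : ℝ)⌋₊) atTop atTop :=
    tendsto_nat_floor_atTop.comp ((tendsto_rpow_atTop (by norm_num)).comp hcast)
  filter_upwards [hfl.eventually e3, hfl.eventually e4, hfl.eventually e5,
    eventually_gt_atTop 0] with n h3 h4 h5 hn
  have hnr : (0 : ℝ) ≤ n := Nat.cast_nonneg n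
  have hpow : ((n : ℝ) ^ (1 / 10 : ℝ)) ^ 10 = n := by
    rw [← Real.rpow_natCast, ← Real.rpow_mul hnr]; norm_num
  have hs1 : ⌊(n : ℝ) ^ (1 / 10 : ℝ)⌋₊ ^ 10 ≤ n := by
    have h := Nat.floor_le (Real.rpow_nonneg hnr (1 / 10 : ℝ))
    have h' := pow_le_pow_left₀ (Nat.cast_nonneg _) h 10
    rw [hpow] at h'
    exact_mod_cast h'
  have hs2 : n < (⌊(n : ℝ) ^ (1 / 10 : ℝ)⌋₊ + 1) ^ 10 := by
    have h := Nat.lt_floor_add_one ((n : ℝ) ^ (1 / 10 : ℝ))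
    have h' := pow_lt_pow_left₀ h (Real.rpow_nonneg hnr (1 / 10 : ℝ)) (n := 10) (by norm_num)
    rw [hpow] at h'
    exact_mod_cast h'
  generalize ⌊(n : ℝ) ^ (1 / 10 : ℝ)⌋₊ = s at *
  by_contra hcon
  rw [not_le] at hcon
  obtain ⟨m, hm0, hmn, hm⟩ := PL_near α hα1 n hn
  obtain ⟨K, hK⟩ : ∃ K, K = s ^ 2 := ⟨_, rfl⟩
  obtain ⟨L, hL⟩ : ∃ L, L = 1000 * s := ⟨_, rfl⟩
  obtain ⟨T, hT⟩ : ∃ T, T = 1001 * s ^ 2 := ⟨_, rfl⟩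
  obtain ⟨H, hH⟩ : ∃ H : ℝ, H = ((K * L).factorial : ℝ) *
    (((n * (K + 2 * L) : ℕ) : ℝ) ^ T) ^ (K * L) := ⟨_, rfl⟩
  obtain ⟨M, hM⟩ : ∃ M, M = K * L * (L * s) := ⟨_, rfl⟩
  obtain ⟨hA, hB⟩ := PL_asym C hC1 d ε n s hs1 hs2 h5 h3 h4 K L T s hK hL hT rfl H hH M hM
  have hH0 : 0 ≤ H := by rw [hH]; positivity
  have hs0 : 0 < s := by omega
  have hdet : K * L < s * (T + 1 - K) := by
    have : T + 1 - K = 1000 * s ^ 2 + 1 := by rw [hT, hK]; omega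
    rw [this, hK, hL]; nlinarith
  have hKT : K ≤ T := by rw [hK, hT]; omega
  have hKL : 2 ≤ K * L := by
    have h1 : 1 ≤ K := by rw [hK]; exact Nat.pow_pos hs0
    have h2 : 2 ≤ L := by omega
    nlinarith
  have hδ : H * 2 ^ M * ‖α - Complex.exp (2 * Real.pi * Complex.I / n * m)‖ *
      (H * C ^ M) ^ d < 1 / 2 := by
    refine lt_of_le_of_lt ?_ hA
    have hle : ‖α - Complex.exp (2 * Real.pi * Complex.I / n * m)‖ ≤ 2 * Real.exp (-ε * n) := by
      linarith
    have hC0 : 0 ≤ (H * C ^ M) ^ d := by positivity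
    exact mul_le_mul_of_nonneg_right (mul_le_mul_of_nonneg_left hle (by positivity)) hC0
  obtain ⟨Z, hZ0, hZ1, hZ2⟩ := PL_det_ineq α hα1 hαfo C hC1 d hLi n m K L T s hn hm0 hmn
    hdet hKT hKL hs0 H hH M hM hδ
  exact absurd (hB Z hZ0 hZ2) (not_lt.mpr hZ1)

/-- Lower bound for a single root. -/
theorem PL_lower (α : ℂ) (hα : IsAlgebraic ℚ α)
    (hαfo : ∀ j : ℕ, 0 < j → α ^ j ≠ 1) (ε : ℝ) (hε : 0 < ε) :
    ∀ᶠ n : ℕ in atTop, Real.exp (-ε * n) * (max 1 ‖α‖) ^ n ≤ ‖α ^ n - 1‖ := by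
  have hsmall : ∀ᶠ n : ℕ in atTop, Real.exp (-ε * n) ≤ 1 / 2 := by
    have h1 : Tendsto (fun n : ℕ => Real.exp (-ε * n)) atTop (nhds 0) := by
      refine Real.tendsto_exp_atBot.comp ?_
      exact tendsto_natCast_atTop_atTop.const_mul_atTop_of_neg (by linarith)
    exact (h1.eventually (gt_mem_nhds (by norm_num : (0 : ℝ) < 1 / 2))).mono fun n h => le_of_lt h
  rcases lt_trichotomy ‖α‖ 1 with h | h | h
  · have h1 : ∀ᶠ n : ℕ in atTop, ‖α‖ ^ n < 1 / 2 :=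
      (tendsto_pow_atTop_nhds_zero_of_lt_one (norm_nonneg _) h).eventually
        (gt_mem_nhds (by norm_num : (0 : ℝ) < 1 / 2))
    filter_upwards [hsmall, h1] with n h2 h3
    rw [max_eq_left h.le, one_pow, mul_one]
    have := norm_sub_norm_le (1 : ℂ) (α ^ n)
    rw [norm_one, norm_pow, norm_sub_rev] at this
    linarith
  · filter_upwards [PL_core α hα h hαfo ε hε] with n h2
    simpa [h] using h2
  · have h1 : ∀ᶠ n : ℕ in atTop, 2 ≤ ‖α‖ ^ n :=
      (tendsto_pow_atTop_atTop_of_one_lt h).eventually_ge_atTop 2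
    filter_upwards [hsmall, h1] with n h2 h3
    rw [max_eq_right h.le]
    have := norm_sub_norm_le (α ^ n) (1 : ℂ)
    rw [norm_one, norm_pow] at this
    have h4 : Real.exp (-ε * n) * ‖α‖ ^ n ≤ 1 / 2 * ‖α‖ ^ n := by gcongr
    linarith

/-- The limit for a single root. -/
theorem PL_root (α : ℂ) (hα : IsAlgebraic ℚ α)
    (hαfo : ∀ j : ℕ, 0 < j → α ^ j ≠ 1) :
    Tendsto (fun n : ℕ => ‖α ^ n - 1‖ ^ ((n : ℝ)⁻¹)) atTop (nhds (max 1 ‖α‖)) := by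
  set B := max 1 ‖α‖ with hB
  have hB1 : 1 ≤ B := le_max_left _ _
  have hB0 : 0 < B := by linarith
  have hroot : ∀ (n : ℕ), 0 < n → (B ^ n) ^ ((n : ℝ)⁻¹) = B := fun n hn =>
    Real.pow_rpow_inv_natCast hB0.le hn.ne'
  have hinv : Tendsto (fun n : ℕ => ((n : ℝ)⁻¹)) atTop (nhds 0) :=
    tendsto_inv_atTop_nhds_zero_nat
  have hup : Tendsto (fun n : ℕ => (2 : ℝ) ^ ((n : ℝ)⁻¹) * B) atTop (nhds B) := by
    have h1 : Tendsto (fun n : ℕ => (2 : ℝ) ^ ((n : ℝ)⁻¹)) atTop (nhds ((2 : ℝ) ^ (0 : ℝ))) :=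
      ((Real.continuous_const_rpow (by norm_num : (2 : ℝ) ≠ 0)).tendsto 0).comp hinv
    rw [Real.rpow_zero] at h1
    simpa using h1.mul_const B
  refine tendsto_order.mpr ⟨fun a ha => ?_, fun a ha => ?_⟩
  · obtain ⟨ε, hε, hεa⟩ : ∃ ε : ℝ, 0 < ε ∧ a < Real.exp (-ε) * B := by
      have hc : Tendsto (fun x : ℝ => Real.exp (-x) * B) (nhdsWithin 0 (Set.Ioi 0)) (nhds B) := by
        have : Tendsto (fun x : ℝ => Real.exp (-x) * B) (nhds 0) (nhds (Real.exp (-0) * B)) :=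
          Continuous.tendsto (by fun_prop) 0
        simp only [neg_zero, Real.exp_zero, one_mul] at this
        exact this.mono_left nhdsWithin_le_nhds
      obtain ⟨x, hx1, hx2⟩ := ((hc.eventually (lt_mem_nhds ha)).and self_mem_nhdsWithin).exists
      exact ⟨x, hx2, hx1⟩
    filter_upwards [PL_lower α hα hαfo ε hε, eventually_gt_atTop 0] with n h1 hn
    refine hεa.trans_le ?_
    have h2 := Real.rpow_le_rpow (by positivity) h1 (z := (n : ℝ)⁻¹) (by positivity)
    refine le_trans (le_of_eq ?_) h2
    have hn' : (n : ℝ) ≠ 0 := by exact_mod_cast hn.ne'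
    rw [Real.mul_rpow (Real.exp_pos _).le (by positivity), hroot n hn, ← Real.exp_mul]
    congr 2
    field_simp
  · filter_upwards [hup.eventually (gt_mem_nhds ha), eventually_gt_atTop 0] with n h1 hn
    refine lt_of_le_of_lt ?_ h1
    have h2 : ‖α ^ n - 1‖ ≤ 2 * B ^ n := by
      have h3 := norm_sub_le (α ^ n) 1
      rw [norm_one, norm_pow] at h3
      have h4 : ‖α‖ ^ n ≤ B ^ n := pow_le_pow_left₀ (norm_nonneg _) (le_max_right _ _) n
      have h5 : 1 ≤ B ^ n := one_le_pow₀ hB1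
      linarith
    calc ‖α ^ n - 1‖ ^ ((n : ℝ)⁻¹) ≤ (2 * B ^ n) ^ ((n : ℝ)⁻¹) :=
          Real.rpow_le_rpow (norm_nonneg _) h2 (by positivity)
      _ = _ := by rw [Real.mul_rpow (by norm_num) (by positivity), hroot n hn]

theorem PL_multiset (S : Multiset ℂ)
    (hS : ∀ α ∈ S, Tendsto (fun n : ℕ => ‖α ^ n - 1‖ ^ ((n : ℝ)⁻¹)) atTop (nhds (max 1 ‖α‖))) :
    Tendsto (fun n : ℕ => ‖(S.map (fun α => α ^ n - 1)).prod‖ ^ ((n : ℝ)⁻¹)) atTop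
      (nhds ((S.map (fun α => max 1 ‖α‖)).prod)) := by
  induction S using Multiset.induction_on with
  | empty => simp
  | cons a S ih =>
    have h1 := hS a (Multiset.mem_cons_self a S)
    have h2 := ih fun α hα => hS α (Multiset.mem_cons_of_mem hα)
    simp only [Multiset.map_cons, Multiset.prod_cons, norm_mul]
    refine (h1.mul h2).congr fun n => ?_
    rw [Real.mul_rpow (norm_nonneg _) (norm_nonneg _)]

/-- if a nonzero `f ∈ ℤ[t]` does not vanish at any root of unity, then
`|Δ_n(f)|^{1/n} → M_∞(f)` as `n → ∞`. -/
theorem abs_pierceLehmer_pow_inv_tendsto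
    (f : Polynomial ℤ) (hf : f ≠ 0)
    (hru : ∀ ζ : ℂ, IsOfFinOrder ζ → (f.map (Int.castRingHom ℂ)).eval ζ ≠ 0) :
    Tendsto (fun n : ℕ => ‖pierceLehmer ℂ f n‖ ^ ((n : ℝ)⁻¹)) atTop
      (nhds (mahlerMeasure ℂ f)) := by
  have hroots : ∀ α ∈ (f.map (Int.castRingHom ℂ)).roots,
      Tendsto (fun n : ℕ => ‖α ^ n - 1‖ ^ ((n : ℝ)⁻¹)) atTop (nhds (max 1 ‖α‖)) := by
    intro α hα
    have hev : (f.map (Int.castRingHom ℂ)).eval α = 0 := (mem_roots'.mp hα).2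
    refine PL_root α ?_ ?_
    · have hZ : IsAlgebraic ℤ α := by
        refine ⟨f, hf, ?_⟩
        rw [aeval_def, ← eval_map]
        exact hev
      exact (IsFractionRing.isAlgebraic_iff ℤ ℚ ℂ).mp hZ
    · intro j hj hj1
      exact hru α (isOfFinOrder_iff_pow_eq_one.mpr ⟨j, hj, hj1⟩) hev
  have h1 := PL_multiset _ hroots
  have h2 := h1.const_mul ‖(f.map (Int.castRingHom ℂ)).leadingCoeff‖
  unfold pierceLehmer _root_.mahlerMeasure
  refine h2.congr' ?_
  filter_upwards [eventually_gt_atTop 0] with n hn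
  rw [norm_mul, Real.mul_rpow (norm_nonneg _) (norm_nonneg _), norm_pow,
    Real.pow_rpow_inv_natCast (norm_nonneg _) hn.ne']
end
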